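/- arXiv:2504.11645 — 4 statements merged into one kernel-verified Lean document; each statement's English description precedes it below -/
import Mathlib

section
/- Suppose M > 1 and H = 2. Consider the noiseless local SA iteration, and suppose the step-size η > 0 is chosen so that the matrix F := I + 2ηĀ + η²Ā' is Schur-stable (spectral radius strictly less than 1). Then the error e_t := θ̄^{(t)} − θ* converges as t → ∞ to ηv, where v = (1/M)(2Ā + ηĀ')^{-1} Σ_{i=1}^M Ā_i²(θ*_i − θ*). In particular, the limiting error is nonzero whenever v ≠ 0. -/
open MeasureTheory ProbabilityTheory Filter Finset
open scoped RealInnerProductSpace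

/-- Noiseless local SA iterates at one agent: `θ_{ℓ+1} = θ_ℓ + η (A θ_ℓ - b)`. -/
noncomputable def linLocal {d M : ℕ} (A : Fin M → Matrix (Fin d) (Fin d) ℝ)
    (b : Fin M → Fin d → ℝ) (η : ℝ) (i : Fin M) (θb : Fin d → ℝ) : ℕ → Fin d → ℝ
  | 0 => θb
  | ℓ + 1 => linLocal A b η i θb ℓ + η • ((A i).mulVec (linLocal A b η i θb ℓ) - b i)

/-- Noiseless local SA global iterates: each round the server averages the agents'
`H`-step local iterates started from the current global parameter. -/
noncomputable def linGlobal {d M : ℕ} (A : Fin M → Matrix (Fin d) (Fin d) ℝ)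
    (b : Fin M → Fin d → ℝ) (η : ℝ) (H : ℕ) (θ0 : Fin d → ℝ) : ℕ → Fin d → ℝ
  | 0 => θ0
  | t + 1 => (M : ℝ)⁻¹ • ∑ i, linLocal A b η i (linGlobal A b η H θ0 t) H

/-- In a complex Banach algebra, the powers of an element whose spectrum lies in the open unit
disc tend to zero in norm. -/
theorem tendsto_norm_pow_of_spectrum_norm_lt_one {R : Type*} [NormedRing R] [NormedAlgebra ℂ R]
    [CompleteSpace R] (a : R) (ha : ∀ z ∈ spectrum ℂ a, ‖z‖ < 1) :
    Tendsto (fun n : ℕ => ‖a ^ n‖) atTop (nhds 0) := by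
  cases subsingleton_or_nontrivial R
  · simp [Subsingleton.elim _ (0 : R)]
  have hρ : spectralRadius ℂ a < 1 := by
    exact_mod_cast spectrum.spectralRadius_lt_of_forall_lt a (r := 1) (fun z hz => ha z hz)
  obtain ⟨r, hr, hr1⟩ := exists_between hρ
  lift r to NNReal using (hr1.trans ENNReal.one_lt_top).ne
  have hr1' : r < 1 := by exact_mod_cast hr1
  have hev := (spectrum.pow_nnnorm_pow_one_div_tendsto_nhds_spectralRadius a).eventually_lt_const hr
  refine squeeze_zero' (Eventually.of_forall fun n => norm_nonneg _) ?_
    (tendsto_pow_atTop_nhds_zero_of_lt_one r.coe_nonneg hr1')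
  filter_upwards [hev, eventually_gt_atTop 0] with n hn hn0
  have hpow := ENNReal.rpow_le_rpow hn.le (Nat.cast_nonneg n : (0 : ℝ) ≤ n)
  rw [← ENNReal.rpow_mul, one_div_mul_cancel (by positivity), ENNReal.rpow_one,
    ENNReal.rpow_natCast] at hpow
  exact_mod_cast hpow

/-- The powers of a Schur-stable complex matrix tend to zero entrywise. -/
theorem Matrix.tendsto_pow_apply_of_spectrum_norm_lt_one {n : Type*} [Fintype n] [DecidableEq n]
    (B : Matrix n n ℂ) (hB : ∀ z ∈ spectrum ℂ B, ‖z‖ < 1) (i j : n) :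
    Tendsto (fun t : ℕ => (B ^ t) i j) atTop (nhds 0) := by
  let _ : NormedRing (Matrix n n ℂ) := Matrix.linftyOpNormedRing
  let _ : NormedAlgebra ℂ (Matrix n n ℂ) := Matrix.linftyOpNormedAlgebra
  have hle (C : Matrix n n ℂ) : ‖C i j‖ ≤ ‖C‖ := by
    rw [← coe_nnnorm, ← coe_nnnorm, NNReal.coe_le_coe, Matrix.linfty_opNNNorm_def]
    exact (Finset.single_le_sum (f := fun k => ‖C i k‖₊) (fun _ _ => zero_le) (mem_univ j)).trans
      (Finset.le_sup (f := fun k => ∑ l, ‖C k l‖₊) (mem_univ i))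
  exact squeeze_zero_norm (fun t => hle (B ^ t)) (tendsto_norm_pow_of_spectrum_norm_lt_one B hB)

/-- The powers of a Schur-stable real matrix, applied to any vector, tend to zero. -/
theorem Matrix.tendsto_pow_mulVec_of_spectrum_norm_lt_one {n : Type*} [Fintype n] [DecidableEq n]
    (F : Matrix n n ℝ) (hF : ∀ z ∈ spectrum ℂ (F.map (algebraMap ℝ ℂ)), ‖z‖ < 1) (x : n → ℝ) :
    Tendsto (fun t : ℕ => (F ^ t).mulVec x) atTop (nhds 0) := by
  have hentry (i j : n) : Tendsto (fun t : ℕ => (F ^ t) i j) atTop (nhds 0) := by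
    have h := (Complex.continuous_re.tendsto 0).comp
      (Matrix.tendsto_pow_apply_of_spectrum_norm_lt_one _ hF i j)
    refine h.congr fun t => ?_
    have hpow : F.map (algebraMap ℝ ℂ) ^ t = (F ^ t).map (algebraMap ℝ ℂ) :=
      (map_pow (algebraMap ℝ ℂ).mapMatrix F t).symm
    rw [Function.comp_apply, hpow, Matrix.map_apply, Complex.coe_algebraMap, Complex.ofReal_re]
  refine tendsto_pi_nhds.2 fun i => ?_
  simpa [Matrix.mulVec, dotProduct] using
    tendsto_finsetSum univ fun j _ => (hentry i j).mul_const (x j)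

/-- A real Schur-stable matrix does not have `1` as an eigenvalue. -/
theorem Matrix.isUnit_one_sub_of_spectrum_norm_lt_one {n : Type*} [Fintype n] [DecidableEq n]
    (F : Matrix n n ℝ) (hF : ∀ z ∈ spectrum ℂ (F.map (algebraMap ℝ ℂ)), ‖z‖ < 1) :
    IsUnit (1 - F) := by
  have h1 : (1 : ℂ) ∉ spectrum ℂ (F.map (algebraMap ℝ ℂ)) := fun h => by
    simpa using hF 1 h
  rw [spectrum.notMem_iff, map_one, Matrix.isUnit_iff_isUnit_det] at h1
  have hmap : (1 : Matrix n n ℂ) - F.map (algebraMap ℝ ℂ) = (algebraMap ℝ ℂ).mapMatrix (1 - F) := by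
    rw [map_sub, map_one, RingHom.mapMatrix_apply]
  rw [hmap, ← RingHom.map_det, isUnit_map_iff] at h1
  exact (Matrix.isUnit_iff_isUnit_det _).2 h1

/-- An affine iteration with Schur-stable linear part converges to its fixed point. -/
theorem tendsto_affine_iteration_of_spectrum_norm_lt_one {n : Type*} [Fintype n] [DecidableEq n]
    (F : Matrix n n ℝ) (hF : ∀ z ∈ spectrum ℂ (F.map (algebraMap ℝ ℂ)), ‖z‖ < 1)
    (c x : n → ℝ) (hx : F.mulVec x + c = x) (e : ℕ → n → ℝ)
    (he : ∀ t, e (t + 1) = F.mulVec (e t) + c) :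
    Tendsto e atTop (nhds x) := by
  have hdiff (t : ℕ) : e t = (F ^ t).mulVec (e 0 - x) + x := by
    induction t with
    | zero => simp
    | succ t ih =>
      rw [he, ih, Matrix.mulVec_add, add_assoc, hx, pow_succ', Matrix.mulVec_mulVec]
  simpa [← hdiff] using
    (Matrix.tendsto_pow_mulVec_of_spectrum_norm_lt_one F hF (e 0 - x)).add_const x

/-- With two local steps, the error of local SA relative to a root `x` of the averaged operator
follows an affine iteration. -/
theorem linGlobal_two_error_succ {d M : ℕ} (hM : M ≠ 0)
    (A : Fin M → Matrix (Fin d) (Fin d) ℝ) (b : Fin M → Fin d → ℝ)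
    (hA : ∀ i, IsUnit (A i).det) (η : ℝ) (θ0 x : Fin d → ℝ)
    (hx : ((M : ℝ)⁻¹ • ∑ i, A i).mulVec x = (M : ℝ)⁻¹ • ∑ i, b i) (t : ℕ) :
    linGlobal A b η 2 θ0 (t + 1) - x =
      ((1 : Matrix (Fin d) (Fin d) ℝ) + (2 * η) • ((M : ℝ)⁻¹ • ∑ i, A i) +
        (η ^ 2) • ((M : ℝ)⁻¹ • ∑ i, A i ^ 2)).mulVec (linGlobal A b η 2 θ0 t - x) +
      -(η ^ 2 • (M : ℝ)⁻¹ • ∑ i, (A i ^ 2).mulVec ((A i)⁻¹.mulVec (b i) - x)) := by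
  have hMR : (M : ℝ) ≠ 0 := by exact_mod_cast hM
  have hlocal (i : Fin M) (θ : Fin d → ℝ) : linLocal A b η i θ 2 =
      x + (θ - x) + (2 * η) • ((A i).mulVec (θ - x) + ((A i).mulVec x - b i)) +
        η ^ 2 • ((A i ^ 2).mulVec (θ - x)
          - (A i ^ 2).mulVec ((A i)⁻¹.mulVec (b i) - x)) := by
    have hb : (A i ^ 2).mulVec ((A i)⁻¹.mulVec (b i)) = (A i).mulVec (b i) := by
      rw [Matrix.mulVec_mulVec, sq, Matrix.mul_assoc, Matrix.mul_nonsing_inv _ (hA i),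
        Matrix.mul_one]
    have hsq (y : Fin d → ℝ) : (A i ^ 2).mulVec y = (A i).mulVec ((A i).mulVec y) := by
      rw [Matrix.mulVec_mulVec, sq]
    simp only [linLocal, Matrix.mulVec_sub, hb]
    simp only [hsq, Matrix.mulVec_add, Matrix.mulVec_sub, Matrix.mulVec_smul]
    module
  have hroot : (M : ℝ)⁻¹ • ∑ i, ((A i).mulVec x - b i) = 0 := by
    rw [sum_sub_distrib, smul_sub, ← hx, Matrix.smul_mulVec, Matrix.sum_mulVec, sub_self]
  have hconst (y : Fin d → ℝ) : (M : ℝ)⁻¹ • ∑ _i : Fin M, y = y := by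
    rw [sum_const, card_univ, Fintype.card_fin, ← Nat.cast_smul_eq_nsmul ℝ, inv_smul_smul₀ hMR]
  rw [linGlobal]
  simp only [hlocal]
  generalize linGlobal A b η 2 θ0 t - x = e
  simp only [sum_add_distrib, sum_sub_distrib, ← smul_sum, smul_add, smul_sub, hconst,
    Matrix.add_mulVec, Matrix.one_mulVec, Matrix.smul_mulVec, Matrix.sum_mulVec] at hroot ⊢
  rw [sub_eq_zero] at hroot
  simp only [smul_comm (M : ℝ)⁻¹ (2 * η), smul_comm (M : ℝ)⁻¹ (η ^ 2), hroot]
  module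

/-- Proposition 1 (heterogeneity bias of vanilla local SA): with `M > 1` agents, `H = 2`
local steps, noiseless linear operators `Ḡ_i(θ) = Ā_i θ - b̄_i`, and a step-size `η > 0`
making `F = I + 2ηĀ + η²Ā'` Schur-stable, the error `e_t = θ̄^{(t)} - θ*` converges to
`η v` with `v = (1/M)(2Ā + ηĀ')⁻¹ ∑_i Ā_i²(θ*_i - θ*)`; in particular the limiting error
is nonzero whenever `v ≠ 0`. -/
theorem local_sa_heterogeneity_bias {d M : ℕ} (hM : 1 < M) (H : ℕ) (hH : H = 2)
    (A : Fin M → Matrix (Fin d) (Fin d) ℝ) (b : Fin M → Fin d → ℝ)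
    (hA : ∀ i, IsUnit (A i).det)
    (hAbar : IsUnit ((M : ℝ)⁻¹ • ∑ i, A i).det)
    (η : ℝ) (hη : 0 < η)
    (hSchur : ∀ z ∈ spectrum ℂ
      (((1 : Matrix (Fin d) (Fin d) ℝ) + (2 * η) • ((M : ℝ)⁻¹ • ∑ i, A i) +
        (η ^ 2) • ((M : ℝ)⁻¹ • ∑ i, A i ^ 2)).map (algebraMap ℝ ℂ)), ‖z‖ < 1)
    (θ0 : Fin d → ℝ) :
    Filter.Tendsto (fun t => linGlobal A b η H θ0 t - (((M : ℝ)⁻¹ • ∑ i, A i)⁻¹.mulVec ((M : ℝ)⁻¹ • ∑ i, b i))) Filter.atTop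
      (nhds (η • ((M : ℝ)⁻¹ • (((2 : ℝ) • ((M : ℝ)⁻¹ • ∑ i, A i) + η • ((M : ℝ)⁻¹ • ∑ i, A i ^ 2))⁻¹).mulVec (∑ i, (A i ^ 2).mulVec ((A i)⁻¹.mulVec (b i) - (((M : ℝ)⁻¹ • ∑ i, A i)⁻¹.mulVec ((M : ℝ)⁻¹ • ∑ i, b i))))))) ∧
    (((M : ℝ)⁻¹ • (((2 : ℝ) • ((M : ℝ)⁻¹ • ∑ i, A i) + η • ((M : ℝ)⁻¹ • ∑ i, A i ^ 2))⁻¹).mulVec (∑ i, (A i ^ 2).mulVec ((A i)⁻¹.mulVec (b i) - (((M : ℝ)⁻¹ • ∑ i, A i)⁻¹.mulVec ((M : ℝ)⁻¹ • ∑ i, b i))))) ≠ 0 → η • ((M : ℝ)⁻¹ • (((2 : ℝ) • ((M : ℝ)⁻¹ • ∑ i, A i) + η • ((M : ℝ)⁻¹ • ∑ i, A i ^ 2))⁻¹).mulVec (∑ i, (A i ^ 2).mulVec ((A i)⁻¹.mulVec (b i) - (((M : ℝ)⁻¹ • ∑ i, A i)⁻¹.mulVec ((M : ℝ)⁻¹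 • ∑ i, b i))))) ≠ 0) := by
  subst hH
  refine ⟨?_, fun hv => smul_ne_zero hη.ne' hv⟩
  set Abar := (M : ℝ)⁻¹ • ∑ i, A i with hAb
  set Asq := (M : ℝ)⁻¹ • ∑ i, A i ^ 2 with hAs
  set x := Abar⁻¹.mulVec ((M : ℝ)⁻¹ • ∑ i, b i) with hxdef
  have hx : Abar.mulVec x = (M : ℝ)⁻¹ • ∑ i, b i := by
    rw [hxdef, Matrix.mulVec_mulVec, Matrix.mul_nonsing_inv _ hAbar, Matrix.one_mulVec]
  set N := (2 : ℝ) • Abar + η • Asq with hN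
  have hF : 1 + (2 * η) • Abar + η ^ 2 • Asq = 1 + η • N := by
    rw [hN]; module
  have hNdet : IsUnit N.det := by
    have h := Matrix.isUnit_one_sub_of_spectrum_norm_lt_one _ hSchur
    rw [hF, sub_add_cancel_left, IsUnit.neg_iff] at h
    rw [← Matrix.isUnit_iff_isUnit_det]
    exact (isUnit_smul_iff (Units.mk0 η hη.ne') N).1 h
  refine tendsto_affine_iteration_of_spectrum_norm_lt_one _ hSchur _ _ ?_ _
    (linGlobal_two_error_succ (by omega) A b hA η θ0 x hx)
  rw [hF, Matrix.add_mulVec, Matrix.one_mulVec, Matrix.smul_mulVec, Matrix.mulVec_smul,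
    Matrix.mulVec_smul, Matrix.mulVec_mulVec, Matrix.mul_nonsing_inv _ hNdet, Matrix.one_mulVec]
  module
end

section
/- Suppose H = 2. Then for every round t ≥ 0, the global error e_t := θ̄^{(t)} − θ* satisfies the exact linear recursion e_{t+1} = (I + 2ηĀ + η²Ā') e_t + (η²/M) Σ_{i=1}^M Ā_i²(θ* − θ*_i). -/
open MeasureTheory ProbabilityTheory Filter Finset
open scoped RealInnerProductSpace

theorem linLocal_two {d M : ℕ} (A : Fin M → Matrix (Fin d) (Fin d) ℝ)
    (b : Fin M → Fin d → ℝ) (η : ℝ) (i : Fin M) (θ : Fin d → ℝ) (hA : IsUnit (A i).det) :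
    linLocal A b η i θ 2 = θ + (2 * η) • ((A i).mulVec θ - b i) +
      (η ^ 2) • (A i ^ 2).mulVec (θ - (A i)⁻¹.mulVec (b i)) := by
  have h : (A i ^ 2).mulVec ((A i)⁻¹.mulVec (b i)) = (A i).mulVec (b i) := by
    rw [Matrix.mulVec_mulVec, pow_two, Matrix.mul_assoc, Matrix.mul_nonsing_inv _ hA,
      Matrix.mul_one]
  rw [Matrix.mulVec_sub, h, pow_two (A i), ← Matrix.mulVec_mulVec]
  simp only [linLocal, Matrix.mulVec_add, Matrix.mulVec_sub, Matrix.mulVec_smul]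
  module

/-- The exact error recursion for noiseless linear local SA with `H = 2` local steps:
`e_{t+1} = (I + 2ηĀ + η²Ā') e_t + (η²/M) ∑_i Ā_i² (θ* - θ*_i)`. -/
theorem local_sa_error_recursion {d M : ℕ} (hM : 0 < M) (H : ℕ) (hH : H = 2)
    (A : Fin M → Matrix (Fin d) (Fin d) ℝ) (b : Fin M → Fin d → ℝ)
    (hA : ∀ i, IsUnit (A i).det)
    (hAbar : IsUnit ((M : ℝ)⁻¹ • ∑ i, A i).det)
    (η : ℝ) (hη : 0 < η)
    (θ0 : Fin d → ℝ) (t : ℕ) :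
    linGlobal A b η H θ0 (t + 1) - (((M : ℝ)⁻¹ • ∑ i, A i)⁻¹.mulVec ((M : ℝ)⁻¹ • ∑ i, b i)) =
      ((1 : Matrix (Fin d) (Fin d) ℝ) + (2 * η) • ((M : ℝ)⁻¹ • ∑ i, A i) +
        (η ^ 2) • ((M : ℝ)⁻¹ • ∑ i, A i ^ 2)).mulVec (linGlobal A b η H θ0 t - (((M : ℝ)⁻¹ • ∑ i, A i)⁻¹.mulVec ((M : ℝ)⁻¹ • ∑ i, b i))) +
      (η ^ 2 / (M : ℝ)) • ∑ i, (A i ^ 2).mulVec ((((M : ℝ)⁻¹ • ∑ i, A i)⁻¹.mulVec ((M : ℝ)⁻¹ • ∑ i, b i)) - (A i)⁻¹.mulVec (b i)) := by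
  subst hH
  have hM' : (M : ℝ) ≠ 0 := by positivity
  have hroot : ((M : ℝ)⁻¹ • ∑ i, A i).mulVec
      (((M : ℝ)⁻¹ • ∑ i, A i)⁻¹.mulVec ((M : ℝ)⁻¹ • ∑ i, b i)) = (M : ℝ)⁻¹ • ∑ i, b i := by
    rw [Matrix.mulVec_mulVec, Matrix.mul_nonsing_inv _ hAbar, Matrix.one_mulVec]
  simp only [linGlobal, linLocal_two A b η _ _ (hA _)]
  generalize linGlobal A b η 2 θ0 t = θ
  generalize ((M : ℝ)⁻¹ • ∑ i, A i)⁻¹.mulVec ((M : ℝ)⁻¹ • ∑ i, b i) = s at hroot ⊢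
  have hconst : (M : ℝ)⁻¹ • ∑ _i : Fin M, θ = θ := by
    rw [Finset.sum_const, Finset.card_univ, Fintype.card_fin, ← Nat.cast_smul_eq_nsmul ℝ,
      inv_smul_smul₀ hM']
  rw [Matrix.add_mulVec, Matrix.add_mulVec, Matrix.one_mulVec, Matrix.smul_mulVec (2 * η),
    Matrix.mulVec_sub ((M : ℝ)⁻¹ • ∑ i, A i), hroot]
  simp only [Finset.sum_add_distrib, smul_add, hconst, ← Finset.smul_sum,
    Finset.sum_sub_distrib, Matrix.smul_mulVec, Matrix.sum_mulVec, Matrix.mulVec_sub]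
  module
end

section
/- There exists a universal constant C such that under Assumption 1, if the local step-size satisfies η ≤ 1/(LH), then for every agent i, every round t, every local step index 0 ≤ ℓ ≤ H, and every realization of the observation sequences, the FedHSA iterates satisfy ‖θ_{i,ℓ}^{(t)} − θ̄^{(t)}‖² ≤ C·η²L²H²·(‖θ̄^{(t)} − θ*‖² + σ²). -/
open MeasureTheory ProbabilityTheory Filter Finset
open scoped RealInnerProductSpace

/-- The true (mean-path) operator `Ḡ(θ) := E_{o ∼ μ}[G(θ, o)]`. -/
noncomputable def Gbar {d : ℕ} {𝒳 : Type} [MeasurableSpace 𝒳]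
    (G : EuclideanSpace ℝ (Fin d) → 𝒳 → EuclideanSpace ℝ (Fin d))
    (μ : Measure 𝒳) (θ : EuclideanSpace ℝ (Fin d)) : EuclideanSpace ℝ (Fin d) :=
  ∫ x, G θ x ∂μ

/-- The FedHSA local iterates within round `t`, started from the global parameter `θb`:
`θ_{i,ℓ+1}^{(t)} = θ_{i,ℓ}^{(t)} + η (G_i(θ_{i,ℓ}^{(t)}, o_{i,ℓ}^{(t)}) + G(θb) - G_i(θb, o_{i,0}^{(t)}))`,
where `o_{i,ℓ}^{(t)} = o_i(tH+ℓ)` and `G(θb) = (1/M) ∑_j G_j(θb, o_{j,0}^{(t)})`. -/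
noncomputable def hsaLocal {d M : ℕ} {𝒳 Ω : Type}
    (G : Fin M → EuclideanSpace ℝ (Fin d) → 𝒳 → EuclideanSpace ℝ (Fin d))
    (o : Fin M → ℕ → Ω → 𝒳) (η : ℝ) (H t : ℕ)
    (θb : EuclideanSpace ℝ (Fin d)) (ω : Ω) (i : Fin M) :
    ℕ → EuclideanSpace ℝ (Fin d)
  | 0 => θb
  | ℓ + 1 =>
      hsaLocal G o η H t θb ω i ℓ +
        η • (G i (hsaLocal G o η H t θb ω i ℓ) (o i (t * H + ℓ) ω) +
          (M : ℝ)⁻¹ • ∑ j, G j θb (o j (t * H) ω) - G i θb (o i (t * H) ω))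

/-- The FedHSA global (server) iterates: `θ̄^{(0)} = θ0` and
`θ̄^{(t+1)} = θ̄^{(t)} + (αg/M) ∑_i (θ_{i,H}^{(t)} - θ̄^{(t)})`. -/
noncomputable def hsaGlobal {d M : ℕ} {𝒳 Ω : Type}
    (G : Fin M → EuclideanSpace ℝ (Fin d) → 𝒳 → EuclideanSpace ℝ (Fin d))
    (o : Fin M → ℕ → Ω → 𝒳) (η αg : ℝ) (H : ℕ)
    (θ0 : EuclideanSpace ℝ (Fin d)) : ℕ → Ω → EuclideanSpace ℝ (Fin d)
  | 0 => fun _ => θ0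
  | t + 1 => fun ω =>
      hsaGlobal G o η αg H θ0 t ω +
        (αg / (M : ℝ)) • ∑ i,
          (hsaLocal G o η H t (hsaGlobal G o η αg H θ0 t ω) ω i H -
            hsaGlobal G o η αg H θ0 t ω)

/-- Discrete Grönwall inequality for `x (n + 1) ≤ (1 + a) * x n + a * B` with `x 0 ≤ 0`. -/
theorem le_mul_one_add_pow_of_succ_le {x : ℕ → ℝ} {a B : ℝ} (ha : 0 ≤ a) (hB : 0 ≤ B)
    (h0 : x 0 ≤ 0) (hx : ∀ n, x (n + 1) ≤ (1 + a) * x n + a * B) (n : ℕ) :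
    x n ≤ n * a * B * (1 + a) ^ n := by
  induction n with
  | zero => simpa using h0
  | succ n ih =>
    have hpow : 1 ≤ (1 + a) ^ (n + 1) := one_le_pow₀ (by linarith)
    calc x (n + 1) ≤ (1 + a) * x n + a * B := hx n
      _ ≤ (1 + a) * (n * a * B * (1 + a) ^ n) + a * B * (1 + a) ^ (n + 1) :=
        add_le_add (by gcongr) (le_mul_of_one_le_right (by positivity) hpow)
      _ = ((n + 1 : ℕ) : ℝ) * a * B * (1 + a) ^ (n + 1) := by push_cast; ring

theorem one_add_pow_le_three {a : ℝ} {H n : ℕ} (ha : 0 ≤ a) (haH : a * H ≤ 1) (hn : n ≤ H) :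
    (1 + a) ^ n ≤ 3 := by
  have hnH : (n : ℝ) ≤ H := by exact_mod_cast hn
  calc (1 + a) ^ n ≤ Real.exp a ^ n := by
        gcongr
        linarith [Real.add_one_le_exp a]
    _ = Real.exp (n * a) := (Real.exp_nat_mul a n).symm
    _ ≤ Real.exp 1 := Real.exp_le_exp.2 (by nlinarith)
    _ ≤ 3 := by linarith [Real.exp_one_lt_d9]

theorem norm_inv_smul_sum_le {E : Type*} [SeminormedAddCommGroup E] [NormedSpace ℝ E] {M : ℕ}
    (hM : 0 < M) {f : Fin M → E} {K : ℝ} (hf : ∀ j, ‖f j‖ ≤ K) :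
    ‖(M : ℝ)⁻¹ • ∑ j, f j‖ ≤ K := by
  have hM' : (0 : ℝ) < M := by exact_mod_cast hM
  have hsum : ‖∑ j, f j‖ ≤ M * K := by
    simpa using norm_sum_le_of_le univ fun j _ => hf j
  rw [norm_smul, norm_inv, Real.norm_natCast, inv_mul_le_iff₀ hM']
  exact hsum

/-- One local step inflates the drift by a factor `1 + ηL` plus a multiple of the operator bound
`L * K` at the global parameter. -/
theorem norm_hsaLocal_succ_sub_le {d M : ℕ} {𝒳 Ω : Type} (hM : 0 < M)
    {G : Fin M → EuclideanSpace ℝ (Fin d) → 𝒳 → EuclideanSpace ℝ (Fin d)}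
    (o : Fin M → ℕ → Ω → 𝒳) {η L K : ℝ} (hη : 0 ≤ η) (H t : ℕ)
    {θb : EuclideanSpace ℝ (Fin d)} (ω : Ω) (i : Fin M)
    (hLip : ∀ (x : 𝒳) (θ₁ θ₂ : EuclideanSpace ℝ (Fin d)),
      ‖G i θ₁ x - G i θ₂ x‖ ≤ L * ‖θ₁ - θ₂‖)
    (hG : ∀ j x, ‖G j θb x‖ ≤ L * K) (ℓ : ℕ) :
    ‖hsaLocal G o η H t θb ω i (ℓ + 1) - θb‖ ≤
      (1 + η * L) * ‖hsaLocal G o η H t θb ω i ℓ - θb‖ + η * L * (3 * K) := by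
  rw [hsaLocal]
  set θ := hsaLocal G o η H t θb ω i ℓ
  set x := o i (t * H + ℓ) ω
  set g := (M : ℝ)⁻¹ • ∑ j, G j θb (o j (t * H) ω)
  have hg : ‖g‖ ≤ L * K := norm_inv_smul_sum_le hM fun j => hG j _
  have hstep : ‖G i θ x + g - G i θb (o i (t * H) ω)‖ ≤ L * ‖θ - θb‖ + L * (3 * K) :=
    calc ‖G i θ x + g - G i θb (o i (t * H) ω)‖
        = ‖(G i θ x - G i θb x) + G i θb x + g - G i θb (o i (t * H) ω)‖ := by
          rw [sub_add_cancel]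
      _ ≤ ‖G i θ x - G i θb x‖ + ‖G i θb x‖ + ‖g‖ + ‖G i θb (o i (t * H) ω)‖ :=
          (norm_sub_le _ _).trans (by gcongr; exact norm_add₃_le)
      _ ≤ L * ‖θ - θb‖ + L * (3 * K) := by
          linarith [hLip x θ θb, hG i x, hG i (o i (t * H) ω)]
  rw [add_sub_right_comm]
  calc ‖θ - θb + η • (G i θ x + g - G i θb (o i (t * H) ω))‖
      ≤ ‖θ - θb‖ + η * ‖G i θ x + g - G i θb (o i (t * H) ω)‖ := by
        simpa [norm_smul, abs_of_nonneg hη] using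
          norm_add_le (θ - θb) (η • (G i θ x + g - G i θb (o i (t * H) ω)))
    _ ≤ ‖θ - θb‖ + η * (L * ‖θ - θb‖ + L * (3 * K)) := by gcongr
    _ = (1 + η * L) * ‖θ - θb‖ + η * L * (3 * K) := by ring

/-- Deterministic bound on the client drift (Lemma 1): if `η ≤ 1/(LH)` then for every
realization, every round `t`, agent `i` and local step `ℓ ≤ H`,
`‖θ_{i,ℓ}^{(t)} - θ̄^{(t)}‖² ≤ C η² L² H² (‖θ̄^{(t)} - θ*‖² + σ²)`. -/
theorem fedhsa_drift_bound :
    ∃ C : ℝ, ∀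
    (d M H : ℕ) (hM : 0 < M) (hH : 0 < H)
    (𝒳 : Type) [Fintype 𝒳] [MeasurableSpace 𝒳] [MeasurableSingletonClass 𝒳]
    (Ω : Type) (o : Fin M → ℕ → Ω → 𝒳)
    (G : Fin M → EuclideanSpace ℝ (Fin d) → 𝒳 → EuclideanSpace ℝ (Fin d))
    (μloc : Fin M → Measure 𝒳) (hμprob : ∀ i, IsProbabilityMeasure (μloc i))
    (θstar : EuclideanSpace ℝ (Fin d))
    (hroot : (M : ℝ)⁻¹ • ∑ i, Gbar (G i) (μloc i) θstar = 0)
    (L : ℝ) (hL : 1 ≤ L)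
    (hLip : ∀ (i : Fin M) (x : 𝒳) (θ₁ θ₂ : EuclideanSpace ℝ (Fin d)),
      ‖G i θ₁ x - G i θ₂ x‖ ≤ L * ‖θ₁ - θ₂‖)
    (σa : Fin M → ℝ) (hσa : ∀ i, 1 ≤ σa i)
    (hGbnd : ∀ (i : Fin M) (θ : EuclideanSpace ℝ (Fin d)) (x : 𝒳),
      ‖G i θ x‖ ≤ L * (‖θ‖ + σa i))
    (σ : ℝ) (hσ : σ = max (⨆ i, σa i) (max ‖θstar‖ 1))
    (η : ℝ) (hη : 0 < η) (αg : ℝ) (θ0 : EuclideanSpace ℝ (Fin d))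
    (hηs : η ≤ 1 / (L * (H : ℝ))),
    ∀ (ω : Ω) (t : ℕ) (i : Fin M) (ℓ : ℕ), ℓ ≤ H →
      ‖hsaLocal G o η H (t) (hsaGlobal G o η αg H θ0 (t) ω) ω i (ℓ) - hsaGlobal G o η αg H θ0 (t) ω‖ ^ 2 ≤
        C * η ^ 2 * L ^ 2 * (H : ℝ) ^ 2 * (‖hsaGlobal G o η αg H θ0 (t) ω - θstar‖ ^ 2 + σ ^ 2) := by
  refine ⟨405, ?_⟩
  intro d M H hM hH 𝒳 _ _ _ Ω o G μloc _ θstar _ L hL hLip σa _ hGbnd σ hσ η hη αg θ0 hηs ω t i ℓ hℓ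
  set θb := hsaGlobal G o η αg H θ0 t ω
  have hσa_le (j : Fin M) : σa j ≤ σ :=
    hσ ▸ (le_ciSup (Set.finite_range σa).bddAbove j).trans (le_max_left _ _)
  have hstar : ‖θstar‖ ≤ σ := hσ ▸ (le_max_left _ _).trans (le_max_right _ _)
  have hσ0 : 0 ≤ σ := (norm_nonneg _).trans hstar
  have hH' : (0 : ℝ) < H := by exact_mod_cast hH
  have hL0 : 0 < L := by linarith
  set D := ‖θb - θstar‖
  have hD : 0 ≤ D := norm_nonneg _
  have hθb : ‖θb‖ ≤ D + σ := (norm_le_norm_sub_add θb θstar).trans (by gcongr)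
  have hG (j : Fin M) (x : 𝒳) : ‖G j θb x‖ ≤ L * (D + 2 * σ) := by
    refine (hGbnd j θb x).trans (mul_le_mul_of_nonneg_left ?_ hL0.le)
    linarith [hσa_le j]
  have haH : η * L * H ≤ 1 := by
    rw [le_div_iff₀ (by positivity)] at hηs
    linarith
  have ha : 0 ≤ η * L := by positivity
  have hℓ' : (ℓ : ℝ) ≤ H := by exact_mod_cast hℓ
  have hdrift : ‖hsaLocal G o η H t θb ω i ℓ - θb‖ ≤ 9 * (η * L * H) * (D + 2 * σ) :=
    calc ‖hsaLocal G o η H t θb ω i ℓ - θb‖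
        ≤ ℓ * (η * L) * (3 * (D + 2 * σ)) * (1 + η * L) ^ ℓ :=
          le_mul_one_add_pow_of_succ_le (x := fun n => ‖hsaLocal G o η H t θb ω i n - θb‖)
            ha (by positivity) (by simp [hsaLocal])
            (norm_hsaLocal_succ_sub_le hM o hη.le H t ω i (hLip i) hG) ℓ
      _ ≤ H * (η * L) * (3 * (D + 2 * σ)) * 3 := by
          gcongr
          exact one_add_pow_le_three ha haH hℓ
      _ = 9 * (η * L * H) * (D + 2 * σ) := by ring
  calc ‖hsaLocal G o η H t θb ω i ℓ - θb‖ ^ 2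
      ≤ (9 * (η * L * H) * (D + 2 * σ)) ^ 2 := by gcongr
    _ = 81 * (η * L * H) ^ 2 * (D + 2 * σ) ^ 2 := by ring
    _ ≤ 81 * (η * L * H) ^ 2 * (5 * (D ^ 2 + σ ^ 2)) := by
        gcongr
        linarith [sq_nonneg (2 * D - σ)]
    _ = 405 * η ^ 2 * L ^ 2 * (H : ℝ) ^ 2 * (D ^ 2 + σ ^ 2) := by ring
end

section
/- There exist universal constants C̃ ≥ 1 and C such that under Assumptions 1–4, if α_g = 1 and η ≤ 1/(C̃·τ̄·H·L²) (where τ̄ := τ(α²) and α := Hη), then the FedHSA iterates satisfy, for all rounds t ≥ 2τ̄: E‖θ̄^{(t)} − θ̄^{(t−τ̄)}‖² ≤ C·τ̄²L²α²·E‖θ̄^{(t)} − θ*‖² + C·(τ̄²L⁴α⁴σ² + τ̄²L²α²σ²/(MH(1−ρ))). -/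
open MeasureTheory ProbabilityTheory Filter Finset
open scoped RealInnerProductSpace

/-- The mixing time `τ(ε) := max_i min {t ∈ ℕ : c_i ρ_i^t ≤ ε}`. -/
noncomputable def mixTime {M : ℕ} (c ρi : Fin M → ℝ) (ε : ℝ) : ℕ :=
  Finset.univ.sup fun i => sInf {t : ℕ | c i * ρi i ^ t ≤ ε}

section FiniteMarkov

variable {Ω : Type} [MeasurableSpace Ω] {P : Measure Ω} [IsProbabilityMeasure P]

lemma integral_comp_eq_sum {α E : Type} [Fintype α] [MeasurableSpace α]
    [MeasurableSingletonClass α] [NormedAddCommGroup E] [NormedSpace ℝ E] [CompleteSpace E]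
    {Z : Ω → α} (hZ : Measurable Z) (f : α → E) :
    ∫ ω, f (Z ω) ∂P = ∑ z, P.real (Z ⁻¹' {z}) • f z := by
  have : IsProbabilityMeasure (P.map Z) := Measure.isProbabilityMeasure_map hZ.aemeasurable
  rw [← integral_map hZ.aemeasurable (f := f) StronglyMeasurable.of_discrete.aestronglyMeasurable,
    integral_fintype .of_finite]
  refine Finset.sum_congr rfl fun z _ => ?_
  rw [map_measureReal_apply hZ (measurableSet_singleton z)]

lemma measureReal_eq_sum_inter {α : Type} [Fintype α] [MeasurableSpace α]
    [MeasurableSingletonClass α] {Z : Ω → α} (hZ : Measurable Z) {S : Set Ω}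
    (hS : MeasurableSet S) :
    P.real S = ∑ z, P.real (S ∩ Z ⁻¹' {z}) := by
  classical
  rw [← measureReal_biUnion_finset]
  · congr 1
    ext ω
    simp
  · intro a _ b _ hab
    refine Set.disjoint_left.2 fun ω h1 h2 => hab ?_
    exact (h1.2 : Z ω = a).symm.trans h2.2
  · exact fun z _ => hS.inter (hZ (measurableSet_singleton z))

/-- The Markov property on two-time events: given `o k = x` and `o t = z` with `k ≤ t`, the next
state has law `K z`. -/
lemma measureReal_inter_succ {𝒳 : Type} [Fintype 𝒳] [MeasurableSpace 𝒳]
    [MeasurableSingletonClass 𝒳] {o : ℕ → Ω → 𝒳} (hmeas : ∀ t, Measurable (o t))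
    {K : Matrix 𝒳 𝒳 ℝ} (hK0 : ∀ x y, 0 ≤ K x y)
    (hMarkov : ∀ (t : ℕ) (x : ℕ → 𝒳),
      P {ω | ∀ s ≤ t + 1, o s ω = x s} =
        P {ω | ∀ s ≤ t, o s ω = x s} * ENNReal.ofReal (K (x t) (x (t + 1))))
    {k t : ℕ} (hkt : k ≤ t) (x y z : 𝒳) :
    P.real (o k ⁻¹' {x} ∩ o t ⁻¹' {z} ∩ o (t + 1) ⁻¹' {y}) =
      P.real (o k ⁻¹' {x} ∩ o t ⁻¹' {z}) * K z y := by
  have hm : ∀ s w, MeasurableSet (o s ⁻¹' {w}) := fun s w => hmeas s (measurableSet_singleton w)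
  have hZ : Measurable (fun ω (s : Fin (t + 1)) => o s ω) :=
    measurable_pi_lambda _ fun s => hmeas s
  rw [measureReal_eq_sum_inter hZ (((hm k x).inter (hm t z)).inter (hm (t + 1) y)),
    measureReal_eq_sum_inter hZ ((hm k x).inter (hm t z)), Finset.sum_mul]
  refine Finset.sum_congr rfl fun p _ => ?_
  by_cases hp : p ⟨k, by omega⟩ = x ∧ p ⟨t, by omega⟩ = z
  · let q : ℕ → 𝒳 := fun s => if h : s < t + 1 then p ⟨s, h⟩ else y
    have hq : ∀ s (h : s < t + 1), q s = p ⟨s, h⟩ := fun s h => dif_pos h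
    have hqt : q t = z := by rw [hq t (by omega)]; exact hp.2
    have hqy : q (t + 1) = y := by simp [q]
    have h2 : o k ⁻¹' {x} ∩ o t ⁻¹' {z} ∩ (fun ω (s : Fin (t + 1)) => o s ω) ⁻¹' {p} =
        {ω | ∀ s ≤ t, o s ω = q s} := by
      ext ω
      simp only [Set.mem_inter_iff, Set.mem_preimage, Set.mem_singleton_iff, Set.mem_ofPred_eq,
        funext_iff]
      constructor
      · rintro ⟨-, h⟩ s hs
        rw [hq s (by omega)]
        exact h ⟨s, by omega⟩
      · intro h
        refine ⟨⟨?_, ?_⟩, fun s => ?_⟩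
        · rw [h k hkt, hq k (by omega)]; exact hp.1
        · rw [h t le_rfl, hqt]
        · rw [h s (by omega), hq s s.2]
    have h1 : o k ⁻¹' {x} ∩ o t ⁻¹' {z} ∩ o (t + 1) ⁻¹' {y} ∩
        (fun ω (s : Fin (t + 1)) => o s ω) ⁻¹' {p} = {ω | ∀ s ≤ t + 1, o s ω = q s} := by
      rw [Set.inter_right_comm, h2]
      ext ω
      simp only [Set.mem_inter_iff, Set.mem_preimage, Set.mem_singleton_iff, Set.mem_ofPred_eq]
      constructor
      · rintro ⟨h, h'⟩ s hs
        rcases Nat.le_succ_iff.1 hs with hs | rfl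
        · exact h s hs
        · rw [h', hqy]
      · exact fun h => ⟨fun s hs => h s (by omega), by rw [h _ le_rfl, hqy]⟩
    rw [h1, h2, measureReal_def, hMarkov, ENNReal.toReal_mul, ENNReal.toReal_ofReal (hK0 _ _),
      hqt, hqy, measureReal_def]
  · have h2 : o k ⁻¹' {x} ∩ o t ⁻¹' {z} ∩ (fun ω (s : Fin (t + 1)) => o s ω) ⁻¹' {p} = ∅ := by
      refine Set.eq_empty_of_forall_notMem fun ω hω => hp ?_
      have h := hω.2
      simp only [Set.mem_preimage, Set.mem_singleton_iff] at h
      subst h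
      exact ⟨hω.1.1, hω.1.2⟩
    rw [Set.inter_right_comm, h2]
    simp

/-- The two-time law of a Markov chain in terms of powers of its transition matrix. -/
lemma measureReal_inter_eq_mul_pow {𝒳 : Type} [Fintype 𝒳] [DecidableEq 𝒳] [MeasurableSpace 𝒳]
    [MeasurableSingletonClass 𝒳] {o : ℕ → Ω → 𝒳} (hmeas : ∀ t, Measurable (o t))
    {K : Matrix 𝒳 𝒳 ℝ} (hK0 : ∀ x y, 0 ≤ K x y)
    (hMarkov : ∀ (t : ℕ) (x : ℕ → 𝒳),
      P {ω | ∀ s ≤ t + 1, o s ω = x s} =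
        P {ω | ∀ s ≤ t, o s ω = x s} * ENNReal.ofReal (K (x t) (x (t + 1))))
    (k m : ℕ) (x y : 𝒳) :
    P.real (o k ⁻¹' {x} ∩ o (k + m) ⁻¹' {y}) = P.real (o k ⁻¹' {x}) * (K ^ m) x y := by
  have hm : ∀ s w, MeasurableSet (o s ⁻¹' {w}) := fun s w => hmeas s (measurableSet_singleton w)
  induction m generalizing y with
  | zero =>
    by_cases hxy : x = y
    · subst hxy; simp
    · have : o k ⁻¹' {x} ∩ o (k + 0) ⁻¹' {y} = ∅ := by
        refine Set.eq_empty_of_forall_notMem fun ω hω => hxy ?_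
        exact (hω.1 : o k ω = x).symm.trans hω.2
      rw [this]
      simp [Matrix.one_apply_ne hxy]
  | succ m ih =>
    rw [measureReal_eq_sum_inter (hmeas (k + m)) ((hm _ _).inter (hm _ _)), pow_succ,
      Matrix.mul_apply, Finset.mul_sum]
    refine Finset.sum_congr rfl fun z _ => ?_
    rw [Set.inter_right_comm, ← add_assoc,
      measureReal_inter_succ hmeas hK0 hMarkov (Nat.le_add_right k m), ih, mul_assoc]

section Correlation

variable {𝒳 E : Type} [Fintype 𝒳] [MeasurableSpace 𝒳] [MeasurableSingletonClass 𝒳]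
  [NormedAddCommGroup E] [InnerProductSpace ℝ E]

lemma sum_measureReal_preimage_eq_one {Z : Ω → 𝒳} (hZ : Measurable Z) :
    ∑ x, P.real (Z ⁻¹' {x}) = 1 := by
  have := measureReal_eq_sum_inter (P := P) hZ MeasurableSet.univ
  simpa using this.symm

lemma integral_inner_eq_sum {Z W : Ω → 𝒳} (hZ : Measurable Z) (hW : Measurable W) (X Y : 𝒳 → E) :
    ∫ ω, ⟪X (Z ω), Y (W ω)⟫ ∂P =
      ∑ x, ∑ y, P.real (Z ⁻¹' {x} ∩ W ⁻¹' {y}) * ⟪X x, Y y⟫ := by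
  rw [integral_comp_eq_sum (Z := fun ω => (Z ω, W ω)) (hZ.prodMk hW)
    (fun p : 𝒳 × 𝒳 => (⟪X p.1, Y p.2⟫ : ℝ)), Fintype.sum_prod_type]
  refine Finset.sum_congr rfl fun x _ => Finset.sum_congr rfl fun y _ => ?_
  rw [smul_eq_mul, ← Set.singleton_prod_singleton, Set.mk_preimage_prod]

lemma integral_inner_indep_le {Z W : Ω → 𝒳} (hZ : Measurable Z) (hW : Measurable W)
    (hZW : IndepFun Z W P) {X Y : 𝒳 → E} {a b : ℝ}
    (hX : ‖∑ x, P.real (Z ⁻¹' {x}) • X x‖ ≤ a) (hY : ‖∑ y, P.real (W ⁻¹' {y}) • Y y‖ ≤ b) :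
    ∫ ω, ⟪X (Z ω), Y (W ω)⟫ ∂P ≤ a * b := by
  rw [integral_inner_eq_sum hZ hW]
  calc _ = ⟪∑ x, P.real (Z ⁻¹' {x}) • X x, ∑ y, P.real (W ⁻¹' {y}) • Y y⟫ := by
        rw [sum_inner]
        refine Finset.sum_congr rfl fun x _ => ?_
        rw [inner_sum]
        refine Finset.sum_congr rfl fun y _ => ?_
        have := hZW.measure_inter_preimage_eq_mul _ _ (measurableSet_singleton x)
          (measurableSet_singleton y)
        rw [measureReal_def, this, ENNReal.toReal_mul, ← measureReal_def, ← measureReal_def]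
        simp only [inner_smul_left, inner_smul_right, conj_trivial]
        ring
    _ ≤ a * b := (real_inner_le_norm _ _).trans (mul_le_mul hX hY (norm_nonneg _)
          ((norm_nonneg _).trans hX))

variable [DecidableEq 𝒳] {o : ℕ → Ω → 𝒳} {K : Matrix 𝒳 𝒳 ℝ}

/-- A centred observable has small mean after the mixing time. -/
lemma norm_sum_measureReal_smul_le (hmeas : ∀ t, Measurable (o t)) (hK0 : ∀ x y, 0 ≤ K x y)
    (hMarkov : ∀ (t : ℕ) (x : ℕ → 𝒳),
      P {ω | ∀ s ≤ t + 1, o s ω = x s} =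
        P {ω | ∀ s ≤ t, o s ω = x s} * ENNReal.ofReal (K (x t) (x (t + 1))))
    {X : 𝒳 → E} {b : ℝ} {k : ℕ} (hX : ∀ x, ‖∑ y, (K ^ k) x y • X y‖ ≤ b) :
    ‖∑ y, P.real (o k ⁻¹' {y}) • X y‖ ≤ b := by
  have h : ∑ y, P.real (o k ⁻¹' {y}) • X y =
      ∑ x, P.real (o 0 ⁻¹' {x}) • ∑ y, (K ^ k) x y • X y := by
    simp only [Finset.smul_sum, smul_smul]
    rw [Finset.sum_comm]
    refine Finset.sum_congr rfl fun y _ => ?_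
    rw [← Finset.sum_smul, measureReal_eq_sum_inter (hmeas 0) (hmeas k (measurableSet_singleton y))]
    congr 1
    refine Finset.sum_congr rfl fun x _ => ?_
    rw [Set.inter_comm, ← measureReal_inter_eq_mul_pow hmeas hK0 hMarkov, zero_add]
  rw [h]
  calc _ ≤ ∑ x, P.real (o 0 ⁻¹' {x}) * b := by
        refine norm_sum_le_of_le _ fun x _ => ?_
        rw [norm_smul, Real.norm_of_nonneg measureReal_nonneg]
        exact mul_le_mul_of_nonneg_left (hX x) measureReal_nonneg
    _ = b := by rw [← Finset.sum_mul, sum_measureReal_preimage_eq_one (hmeas 0), one_mul]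

/-- Decay of the autocorrelation of a centred observable of a Markov chain. -/
lemma integral_inner_markov_le (hmeas : ∀ t, Measurable (o t)) (hK0 : ∀ x y, 0 ≤ K x y)
    (hMarkov : ∀ (t : ℕ) (x : ℕ → 𝒳),
      P {ω | ∀ s ≤ t + 1, o s ω = x s} =
        P {ω | ∀ s ≤ t, o s ω = x s} * ENNReal.ofReal (K (x t) (x (t + 1))))
    {X : 𝒳 → E} {B b : ℝ} (hB : ∀ x, ‖X x‖ ≤ B) (k m : ℕ)
    (hX : ∀ x, ‖∑ y, (K ^ m) x y • X y‖ ≤ b) :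
    ∫ ω, ⟪X (o k ω), X (o (k + m) ω)⟫ ∂P ≤ B * b := by
  rw [integral_inner_eq_sum (hmeas _) (hmeas _)]
  calc _ = ∑ x, P.real (o k ⁻¹' {x}) * ⟪X x, ∑ y, (K ^ m) x y • X y⟫ := by
        refine Finset.sum_congr rfl fun x _ => ?_
        rw [inner_sum, Finset.mul_sum]
        refine Finset.sum_congr rfl fun y _ => ?_
        rw [measureReal_inter_eq_mul_pow hmeas hK0 hMarkov, inner_smul_right, mul_assoc]
    _ ≤ ∑ x, P.real (o k ⁻¹' {x}) * (B * b) := by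
        refine Finset.sum_le_sum fun x _ => mul_le_mul_of_nonneg_left ?_ measureReal_nonneg
        exact (real_inner_le_norm _ _).trans (mul_le_mul (hB x) (hX x) (norm_nonneg _)
          ((norm_nonneg _).trans (hB x)))
    _ = B * b := by rw [← Finset.sum_mul, sum_measureReal_preimage_eq_one (hmeas k), one_mul]

end Correlation

lemma integrable_of_factorsThrough {α E : Type} [Finite α] [MeasurableSpace α]
    [MeasurableSingletonClass α] [NormedAddCommGroup E] {Z : Ω → α} (hZ : Measurable Z)
    {f : Ω → E} (hf : f.FactorsThrough Z) : Integrable f P := by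
  have : IsProbabilityMeasure (P.map Z) := Measure.isProbabilityMeasure_map hZ.aemeasurable
  obtain ⟨g, rfl⟩ := (Function.factorsThrough_iff f).1 hf
  exact (Integrable.of_finite (μ := P.map Z) (f := g)).comp_measurable hZ

lemma card_near_le (a b k T : ℕ) :
    ((Ico a b).filter fun l => k < l + T ∧ l < k + T).card ≤ 2 * T := by
  calc _ ≤ (Ico (k + 1 - T) (k + T)).card := by
        refine Finset.card_le_card fun l hl => ?_
        simp only [Finset.mem_filter, Finset.mem_Ico] at hl ⊢
        omega
    _ ≤ 2 * T := by rw [Nat.card_Ico]; omega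

/-- Second moment of a sum of centred observables of `M` independent Markov chains, when all the
times exceed the `ε`-mixing time `T`. -/
lemma integral_norm_sq_noise_le {M : ℕ} {𝒳 E : Type} [Fintype 𝒳] [DecidableEq 𝒳]
    [MeasurableSpace 𝒳] [MeasurableSingletonClass 𝒳] [NormedAddCommGroup E]
    [InnerProductSpace ℝ E]
    {o : Fin M → ℕ → Ω → 𝒳} (hmeas : ∀ i t, Measurable (o i t)) {K : Fin M → Matrix 𝒳 𝒳 ℝ}
    (hK0 : ∀ i x y, 0 ≤ K i x y)
    (hMarkov : ∀ (i : Fin M) (t : ℕ) (x : ℕ → 𝒳),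
      P {ω | ∀ s ≤ t + 1, o i s ω = x s} =
        P {ω | ∀ s ≤ t, o i s ω = x s} * ENNReal.ofReal (K i (x t) (x (t + 1))))
    (hindep : ∀ i j : Fin M, i ≠ j →
      IndepFun (fun ω (t : ℕ) => o i t ω) (fun ω (t : ℕ) => o j t ω) P)
    {X : Fin M → 𝒳 → E} {B ε : ℝ} {T : ℕ} (hB0 : 0 ≤ B) (hB : ∀ i x, ‖X i x‖ ≤ B)
    (hε0 : 0 ≤ ε) (hε1 : ε ≤ 1)
    (hX : ∀ i x m, T ≤ m → ‖∑ y, (K i ^ m) x y • X i y‖ ≤ 2 * B * ε)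
    {a b : ℕ} (ha : T ≤ a) :
    ∫ ω, ‖∑ i, ∑ k ∈ Ico a b, X i (o i k ω)‖ ^ 2 ∂P ≤
      M * ((b - a : ℕ) : ℝ) * (2 * T) * B ^ 2 +
        (M * ((b - a : ℕ) : ℝ)) ^ 2 * (4 * B ^ 2 * ε) := by
  have hInt : ∀ i j k l, Integrable (fun ω => (⟪X i (o i k ω), X j (o j l ω)⟫ : ℝ)) P :=
    fun i j k l => integrable_of_factorsThrough ((hmeas i k).prodMk (hmeas j l))
      fun ω ω' h => by
        simp only [Prod.mk.injEq] at h
        simp only [h.1, h.2]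
  have hfar : 0 ≤ 4 * B ^ 2 * ε := by positivity
  have hpair : ∀ i j k l, a ≤ k → a ≤ l → ∫ ω, (⟪X i (o i k ω), X j (o j l ω)⟫ : ℝ) ∂P ≤
      (if i = j then (if k < l + T ∧ l < k + T then B ^ 2 else 0) else 0) + 4 * B ^ 2 * ε := by
    intro i j k l hk hl
    split_ifs with hij hnear
    · have h1 : ∫ ω, (⟪X i (o i k ω), X j (o j l ω)⟫ : ℝ) ∂P ≤ ∫ _, B ^ 2 ∂P := by
        refine integral_mono (hInt i j k l) (integrable_const _) fun ω => ?_
        refine (real_inner_le_norm _ _).trans ?_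
        rw [sq]
        exact mul_le_mul (hB _ _) (hB _ _) (norm_nonneg _) hB0
      rw [integral_const, probReal_univ, one_smul] at h1
      linarith
    · subst hij
      have key : ∀ p q, p + T ≤ q → ∫ ω, (⟪X i (o i p ω), X i (o i q ω)⟫ : ℝ) ∂P ≤
          4 * B ^ 2 * ε := by
        intro p q hpq
        obtain ⟨m, rfl⟩ := Nat.exists_eq_add_of_le (show p ≤ q by omega)
        refine (integral_inner_markov_le (hmeas i) (hK0 i) (hMarkov i) (hB i) p m
          fun x => hX i x m (by omega)).trans ?_
        nlinarith [sq_nonneg B]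
      rw [zero_add]
      rcases lt_or_ge k (l + T) with h | h
      · exact key k l (by omega)
      · simp_rw [real_inner_comm (X i (o i l _))]
        exact key l k h
    · rw [zero_add]
      have hZW : IndepFun (o i k) (o j l) P :=
        (hindep i j hij).comp (measurable_pi_apply k) (measurable_pi_apply l)
      refine (integral_inner_indep_le (hmeas i k) (hmeas j l) hZW
        (norm_sum_measureReal_smul_le (hmeas i) (hK0 i) (hMarkov i)
          fun x => hX i x k (ha.trans hk))
        (norm_sum_measureReal_smul_le (hmeas j) (hK0 j) (hMarkov j)
          fun x => hX j x l (ha.trans hl))).trans ?_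
      nlinarith [mul_nonneg (sq_nonneg B) (mul_nonneg hε0 (sub_nonneg.2 hε1))]
  have hexp : ∀ ω, ‖∑ i, ∑ k ∈ Ico a b, X i (o i k ω)‖ ^ 2 =
      ∑ i, ∑ k ∈ Ico a b, ∑ j, ∑ l ∈ Ico a b, (⟪X i (o i k ω), X j (o j l ω)⟫ : ℝ) := by
    intro ω
    rw [← real_inner_self_eq_norm_sq, sum_inner]
    refine Finset.sum_congr rfl fun i _ => ?_
    rw [sum_inner]
    refine Finset.sum_congr rfl fun k _ => ?_
    rw [inner_sum]
    exact Finset.sum_congr rfl fun j _ => inner_sum _ _ _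
  simp_rw [hexp]
  have h1 : ∀ i k j, Integrable
      (fun ω => ∑ l ∈ Ico a b, (⟪X i (o i k ω), X j (o j l ω)⟫ : ℝ)) P :=
    fun i k j => integrable_finsetSum _ fun l _ => hInt i j k l
  have h2 : ∀ i k, Integrable
      (fun ω => ∑ j, ∑ l ∈ Ico a b, (⟪X i (o i k ω), X j (o j l ω)⟫ : ℝ)) P :=
    fun i k => integrable_finsetSum _ fun j _ => h1 i k j
  rw [integral_finsetSum _ fun i _ => integrable_finsetSum _ fun k _ => h2 i k]
  have hrow : ∀ i, ∀ k ∈ Ico a b,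
      ∫ ω, ∑ j, ∑ l ∈ Ico a b, (⟪X i (o i k ω), X j (o j l ω)⟫ : ℝ) ∂P ≤
        2 * T * B ^ 2 + M * ((b - a : ℕ) : ℝ) * (4 * B ^ 2 * ε) := by
    intro i k hk
    rw [integral_finsetSum _ fun j _ => h1 i k j]
    calc _ ≤ ∑ j, ∑ l ∈ Ico a b,
          ((if i = j then (if k < l + T ∧ l < k + T then B ^ 2 else 0) else 0) +
            4 * B ^ 2 * ε) := by
          refine Finset.sum_le_sum fun j _ => ?_
          rw [integral_finsetSum _ fun l _ => hInt i j k l]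
          exact Finset.sum_le_sum fun l hl =>
            hpair i j k l (Finset.mem_Ico.1 hk).1 (Finset.mem_Ico.1 hl).1
      _ = ((Ico a b).filter fun l => k < l + T ∧ l < k + T).card * B ^ 2 +
            M * ((b - a : ℕ) : ℝ) * (4 * B ^ 2 * ε) := by
          simp only [Finset.sum_add_distrib, Finset.sum_const, Finset.card_univ,
            Fintype.card_fin, Nat.card_Ico, nsmul_eq_mul, mul_assoc]
          congr 1
          rw [Finset.sum_eq_single i (fun j _ hj => by simp [hj.symm]) (by simp)]
          simp [← Finset.sum_filter]
      _ ≤ _ := by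
          gcongr
          exact_mod_cast card_near_le a b k T
  calc _ ≤ ∑ _i : Fin M, ∑ _k ∈ Ico a b,
        (2 * T * B ^ 2 + M * ((b - a : ℕ) : ℝ) * (4 * B ^ 2 * ε)) := by
        refine Finset.sum_le_sum fun i _ => ?_
        rw [integral_finsetSum _ fun k _ => h2 i k]
        exact Finset.sum_le_sum fun k hk => hrow i k hk
    _ = _ := by
        simp only [Finset.sum_const, Finset.card_univ, Fintype.card_fin, Nat.card_Ico,
          nsmul_eq_mul]
        ring

end FiniteMarkov

section Dynamics

variable {d M : ℕ} {𝒳 Ω : Type}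
  {G : Fin M → EuclideanSpace ℝ (Fin d) → 𝒳 → EuclideanSpace ℝ (Fin d)}
  {o : Fin M → ℕ → Ω → 𝒳} {η : ℝ} {H : ℕ}

lemma hsaLocal_eq_sum (t : ℕ) (θb : EuclideanSpace ℝ (Fin d)) (ω : Ω) (i : Fin M) (ℓ : ℕ) :
    hsaLocal G o η H t θb ω i ℓ = θb + η • ∑ l ∈ range ℓ,
      (G i (hsaLocal G o η H t θb ω i l) (o i (t * H + l) ω) +
        (M : ℝ)⁻¹ • ∑ j, G j θb (o j (t * H) ω) - G i θb (o i (t * H) ω)) := by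
  induction ℓ with
  | zero => simp [hsaLocal]
  | succ ℓ ih =>
    rw [Finset.sum_range_succ, smul_add, ← add_assoc, ← ih]
    rfl

/-- The control variates cancel in the server update. -/
lemma hsaGlobal_succ_eq (hM : 0 < M) (θ0 : EuclideanSpace ℝ (Fin d)) (t : ℕ) (ω : Ω) :
    hsaGlobal G o η 1 H θ0 (t + 1) ω = hsaGlobal G o η 1 H θ0 t ω +
      (η / M) • ∑ i, ∑ l ∈ range H,
        G i (hsaLocal G o η H t (hsaGlobal G o η 1 H θ0 t ω) ω i l) (o i (t * H + l) ω) := by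
  have hM' : (M : ℝ) ≠ 0 := by positivity
  simp only [hsaGlobal]
  congr 1
  set θ := hsaGlobal G o η 1 H θ0 t ω
  have h : ∀ i, hsaLocal G o η H t θ ω i H - θ =
      η • (∑ l ∈ range H, G i (hsaLocal G o η H t θ ω i l) (o i (t * H + l) ω)) +
        (η * H) • ((M : ℝ)⁻¹ • ∑ j, G j θ (o j (t * H) ω) - G i θ (o i (t * H) ω)) := by
    intro i
    rw [hsaLocal_eq_sum, add_sub_cancel_left]
    simp only [add_sub_assoc, Finset.sum_add_distrib, Finset.sum_const, Finset.card_range]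
    rw [smul_add, ← Nat.cast_smul_eq_nsmul ℝ, smul_smul]
  have hz : ∑ i, ((M : ℝ)⁻¹ • ∑ j, G j θ (o j (t * H) ω) - G i θ (o i (t * H) ω)) = 0 := by
    rw [Finset.sum_sub_distrib, Finset.sum_const, Finset.card_univ, Fintype.card_fin,
      ← Nat.cast_smul_eq_nsmul ℝ, smul_smul, mul_inv_cancel₀ hM', one_smul, sub_self]
  simp_rw [h]
  rw [Finset.sum_add_distrib, ← Finset.smul_sum, ← Finset.smul_sum, hz, smul_zero, add_zero,
    smul_smul]
  congr 1
  ring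

lemma hsaLocal_congr {t N : ℕ} (hN : (t + 1) * H ≤ N) {ω ω' : Ω}
    (h : ∀ i, ∀ k < N, o i k ω = o i k ω') (θb : EuclideanSpace ℝ (Fin d)) (i : Fin M) {ℓ : ℕ}
    (hℓ : ℓ ≤ H) :
    hsaLocal G o η H t θb ω i ℓ = hsaLocal G o η H t θb ω' i ℓ := by
  rw [add_mul, one_mul] at hN
  induction ℓ with
  | zero => rfl
  | succ ℓ ih =>
    simp only [hsaLocal]
    rw [ih (by omega), h i (t * H + ℓ) (by omega), h i (t * H) (by omega),
      Finset.sum_congr rfl fun j _ => by rw [h j (t * H) (by omega)]]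

lemma hsaGlobal_congr {t N : ℕ} (hN : t * H ≤ N) {ω ω' : Ω}
    (h : ∀ i, ∀ k < N, o i k ω = o i k ω') (αg : ℝ) (θ0 : EuclideanSpace ℝ (Fin d)) :
    hsaGlobal G o η αg H θ0 t ω = hsaGlobal G o η αg H θ0 t ω' := by
  induction t with
  | zero => rfl
  | succ t ih =>
    simp only [hsaGlobal]
    rw [ih (le_trans (Nat.mul_le_mul_right H t.le_succ) hN),
      Finset.sum_congr rfl fun i _ => by rw [hsaLocal_congr hN h _ i le_rfl]]

variable {L σ : ℝ}

lemma norm_hsaLocal_sub_le (hη : 0 ≤ η) (hL : 0 ≤ L) (hηL : 2 * (H * η * L) ≤ 1)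
    (hLip : ∀ (i : Fin M) (x : 𝒳) (θ₁ θ₂ : EuclideanSpace ℝ (Fin d)),
      ‖G i θ₁ x - G i θ₂ x‖ ≤ L * ‖θ₁ - θ₂‖)
    (hG : ∀ (i : Fin M) (θ : EuclideanSpace ℝ (Fin d)) (x : 𝒳), ‖G i θ x‖ ≤ L * (‖θ‖ + σ))
    (t : ℕ) (θb : EuclideanSpace ℝ (Fin d)) (ω : Ω) (i : Fin M) {ℓ : ℕ} (hℓ : ℓ ≤ H) :
    ‖hsaLocal G o η H t θb ω i ℓ - θb‖ ≤ 6 * ℓ * (η * L * (‖θb‖ + σ)) := by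
  have hR : 0 ≤ L * (‖θb‖ + σ) := (norm_nonneg _).trans (hG i θb (o i 0 ω))
  have hM : (M : ℝ) ≠ 0 := by
    have := i.pos
    positivity
  have hg : ‖(M : ℝ)⁻¹ • ∑ j, G j θb (o j (t * H) ω)‖ ≤ L * (‖θb‖ + σ) := by
    rw [norm_smul, norm_inv, Real.norm_natCast, inv_mul_le_iff₀ (by positivity)]
    refine (norm_sum_le_of_le _ fun j _ => hG j θb _).trans ?_
    simp
  induction ℓ with
  | zero => simp [hsaLocal]
  | succ ℓ ih =>
    have ih := ih (by omega)
    set u := hsaLocal G o η H t θb ω i ℓ with hu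
    have hstep : hsaLocal G o η H t θb ω i (ℓ + 1) - θb = (u - θb) +
        η • ((G i u (o i (t * H + ℓ) ω) - G i θb (o i (t * H + ℓ) ω)) +
          (G i θb (o i (t * H + ℓ) ω) + (M : ℝ)⁻¹ • ∑ j, G j θb (o j (t * H) ω) -
            G i θb (o i (t * H) ω))) := by
      simp only [hsaLocal, ← hu]
      module
    have h3 : ‖G i θb (o i (t * H + ℓ) ω) + (M : ℝ)⁻¹ • ∑ j, G j θb (o j (t * H) ω) -
            G i θb (o i (t * H) ω)‖ ≤ 3 * (L * (‖θb‖ + σ)) := by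
      refine (norm_sub_le _ _).trans ?_
      have := norm_add_le (G i θb (o i (t * H + ℓ) ω)) ((M : ℝ)⁻¹ • ∑ j, G j θb (o j (t * H) ω))
      linarith [hG i θb (o i (t * H + ℓ) ω), hG i θb (o i (t * H) ω)]
    have hsmall : 2 * (ℓ * η * L) ≤ 1 := by
      have hℓ' : (ℓ : ℝ) ≤ H := by exact_mod_cast (by omega : ℓ ≤ H)
      refine le_trans ?_ hηL
      gcongr
    have h4 : η * (L * ‖u - θb‖) ≤ 3 * (η * L * (‖θb‖ + σ)) := by
      calc η * (L * ‖u - θb‖) ≤ η * (L * (6 * ℓ * (η * L * (‖θb‖ + σ)))) := by gcongr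
        _ = 3 * (2 * (ℓ * η * L)) * (η * (L * (‖θb‖ + σ))) := by ring
        _ ≤ 3 * 1 * (η * (L * (‖θb‖ + σ))) := by gcongr
        _ = _ := by ring
    rw [hstep]
    calc _ ≤ ‖u - θb‖ + η * (L * ‖u - θb‖ + 3 * (L * (‖θb‖ + σ))) := by
          refine (norm_add_le _ _).trans ?_
          rw [norm_smul, Real.norm_of_nonneg hη]
          gcongr
          exact (norm_add_le _ _).trans (add_le_add (hLip _ _ _ _) h3)
      _ ≤ _ := by push_cast; linarith

/-- One communication round is the averaged noise at `θstar` plus a small error. -/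
lemma norm_hsaGlobal_succ_sub_le (hM : 0 < M) (hη : 0 ≤ η) (hL : 0 ≤ L)
    (hηL : 2 * (H * η * L) ≤ 1)
    (hLip : ∀ (i : Fin M) (x : 𝒳) (θ₁ θ₂ : EuclideanSpace ℝ (Fin d)),
      ‖G i θ₁ x - G i θ₂ x‖ ≤ L * ‖θ₁ - θ₂‖)
    (hG : ∀ (i : Fin M) (θ : EuclideanSpace ℝ (Fin d)) (x : 𝒳), ‖G i θ x‖ ≤ L * (‖θ‖ + σ))
    {θstar : EuclideanSpace ℝ (Fin d)} (hσ : ‖θstar‖ ≤ σ)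
    {A : Fin M → EuclideanSpace ℝ (Fin d)} (hA : ∑ i, A i = 0)
    (θ0 : EuclideanSpace ℝ (Fin d)) (t : ℕ) (ω : Ω) :
    ‖hsaGlobal G o η 1 H θ0 (t + 1) ω - hsaGlobal G o η 1 H θ0 t ω -
        (η / M) • ∑ i, ∑ l ∈ range H, (G i θstar (o i (t * H + l) ω) - A i)‖ ≤
      H * η * L * (4 * ‖hsaGlobal G o η 1 H θ0 t ω - θstar‖ + 12 * (H * η * L * σ)) := by
  rw [hsaGlobal_succ_eq hM, add_sub_cancel_left]
  set θ := hsaGlobal G o η 1 H θ0 t ω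
  have hA' : ∑ i, ∑ l ∈ range H, (G i θstar (o i (t * H + l) ω) - A i) =
      ∑ i, ∑ l ∈ range H, G i θstar (o i (t * H + l) ω) := by
    simp only [Finset.sum_sub_distrib, Finset.sum_const, ← Finset.smul_sum, hA, smul_zero,
      sub_zero]
  have hσ0 : 0 ≤ σ := (norm_nonneg _).trans hσ
  have hθ : ‖θ‖ ≤ ‖θ - θstar‖ + σ := by
    linarith [norm_sub_norm_le θ θstar]
  rw [hA', ← smul_sub, ← Finset.sum_sub_distrib]
  simp_rw [← Finset.sum_sub_distrib]
  have hterm : ∀ i, ∀ l ∈ range H,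
      ‖G i (hsaLocal G o η H t θ ω i l) (o i (t * H + l) ω) - G i θstar (o i (t * H + l) ω)‖ ≤
        L * (4 * ‖θ - θstar‖ + 12 * (H * η * L * σ)) := by
    intro i l hl
    have hl := (Finset.mem_range.1 hl).le
    have hl' : (l : ℝ) ≤ H := by exact_mod_cast hl
    refine (hLip _ _ _ _).trans (mul_le_mul_of_nonneg_left ?_ hL)
    have h1 := norm_hsaLocal_sub_le (o := o) hη hL hηL hLip hG t θ ω i hl
    have h2 := norm_sub_le_norm_sub_add_norm_sub (hsaLocal G o η H t θ ω i l) θ θstar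
    have h3 : 6 * l * (η * L * (‖θ‖ + σ)) ≤ 6 * H * (η * L * (‖θ - θstar‖ + σ + σ)) := by
      gcongr
    have h4 := mul_le_mul_of_nonneg_right hηL (norm_nonneg (θ - θstar))
    linarith
  rw [norm_smul, Real.norm_of_nonneg (by positivity)]
  calc _ ≤ η / M * ∑ _i : Fin M, ∑ _l ∈ range H,
        (L * (4 * ‖θ - θstar‖ + 12 * (H * η * L * σ))) := by
        gcongr
        exact norm_sum_le_of_le _ fun i _ => norm_sum_le_of_le _ fun l hl => hterm i l hl
    _ = _ := by
        simp only [Finset.sum_const, Finset.card_univ, Fintype.card_fin, Finset.card_range,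
          nsmul_eq_mul]
        field_simp

lemma sum_Ico_sum_range_mul {E : Type} [AddCommMonoid E] (f : ℕ → E) (H : ℕ) {s t : ℕ}
    (hst : s ≤ t) :
    ∑ r ∈ Ico s t, ∑ l ∈ range H, f (r * H + l) = ∑ k ∈ Ico (s * H) (t * H), f k := by
  induction t, hst using Nat.le_induction with
  | base => simp
  | succ t hst ih =>
    rw [Finset.sum_Ico_succ_top hst, ih, ← Finset.sum_Ico_consecutive f
      (Nat.mul_le_mul_right H hst) (Nat.mul_le_mul_right H t.le_succ),
      Finset.sum_Ico_eq_sum_range f (t * H)]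
    congr 3
    simp [Nat.succ_mul]

/-- Telescoped form of `norm_hsaGlobal_succ_sub_le`, with all errors measured from the final
iterate. -/
lemma norm_sq_hsaGlobal_sub_le (hM : 0 < M) (hη : 0 ≤ η) (hL : 0 ≤ L)
    (hηL : 2 * (H * η * L) ≤ 1)
    (hLip : ∀ (i : Fin M) (x : 𝒳) (θ₁ θ₂ : EuclideanSpace ℝ (Fin d)),
      ‖G i θ₁ x - G i θ₂ x‖ ≤ L * ‖θ₁ - θ₂‖)
    (hG : ∀ (i : Fin M) (θ : EuclideanSpace ℝ (Fin d)) (x : 𝒳), ‖G i θ x‖ ≤ L * (‖θ‖ + σ))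
    {θstar : EuclideanSpace ℝ (Fin d)} (hσ : ‖θstar‖ ≤ σ)
    {A : Fin M → EuclideanSpace ℝ (Fin d)} (hA : ∑ i, A i = 0)
    (θ0 : EuclideanSpace ℝ (Fin d)) {s t : ℕ} (hst : s ≤ t) (ω : Ω) :
    ‖hsaGlobal G o η 1 H θ0 t ω - hsaGlobal G o η 1 H θ0 s ω‖ ^ 2 ≤
      2 * ((η / M) ^ 2 * ‖∑ i, ∑ k ∈ Ico (s * H) (t * H), (G i θstar (o i k ω) - A i)‖ ^ 2) +
        2 * (((t - s : ℕ) : ℝ) * ∑ r ∈ Ico s t,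
          (64 * (H * η * L) ^ 2 * (‖hsaGlobal G o η 1 H θ0 t ω - θstar‖ ^ 2 +
            ‖hsaGlobal G o η 1 H θ0 t ω - hsaGlobal G o η 1 H θ0 r ω‖ ^ 2) +
          288 * ((H * η * L) ^ 4 * σ ^ 2))) := by
  set θ := fun r => hsaGlobal G o η 1 H θ0 r ω
  set e : ℕ → EuclideanSpace ℝ (Fin d) := fun r => θ (r + 1) - θ r -
    (η / M) • ∑ i, ∑ l ∈ range H, (G i θstar (o i (r * H + l) ω) - A i)
  set W := ∑ i, ∑ k ∈ Ico (s * H) (t * H), (G i θstar (o i k ω) - A i)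
  have hdecomp : θ t - θ s = (η / (M : ℝ)) • W + ∑ r ∈ Ico s t, e r := by
    have hWr : (η / (M : ℝ)) • W = ∑ r ∈ Ico s t,
        (η / (M : ℝ)) • ∑ i, ∑ l ∈ range H, (G i θstar (o i (r * H + l) ω) - A i) := by
      rw [← Finset.smul_sum, Finset.sum_comm]
      congr 1
      exact Finset.sum_congr rfl fun i _ =>
        (sum_Ico_sum_range_mul (fun k => G i θstar (o i k ω) - A i) H hst).symm
    rw [← Finset.sum_Ico_sub θ hst, hWr, ← Finset.sum_add_distrib]
    exact Finset.sum_congr rfl fun r _ => (add_sub_cancel _ _).symm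
  have herr : ∀ r, ‖e r‖ ^ 2 ≤ 64 * (H * η * L) ^ 2 * (‖θ t - θstar‖ ^ 2 + ‖θ t - θ r‖ ^ 2) +
      288 * ((H * η * L) ^ 4 * σ ^ 2) := by
    intro r
    have h1 := norm_hsaGlobal_succ_sub_le (o := o) hM hη hL hηL hLip hG hσ hA θ0 r ω
    have h2 : ‖θ r - θstar‖ ≤ ‖θ t - θstar‖ + ‖θ t - θ r‖ := by
      rw [add_comm, norm_sub_rev (θ t) (θ r)]
      exact norm_sub_le_norm_sub_add_norm_sub _ _ _
    have hsq : ∀ x y : ℝ, (x + y) ^ 2 ≤ 2 * x ^ 2 + 2 * y ^ 2 := fun x y => by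
      linarith [sq_nonneg (x - y), add_sq x y, sub_sq x y]
    calc ‖e r‖ ^ 2 ≤ (H * η * L * (4 * ‖θ r - θstar‖ + 12 * (H * η * L * σ))) ^ 2 := by
          gcongr
      _ ≤ (H * η * L) ^ 2 * (2 * (4 * ‖θ r - θstar‖) ^ 2 + 2 * (12 * (H * η * L * σ)) ^ 2) := by
          rw [mul_pow]
          gcongr
          exact hsq _ _
      _ = (H * η * L) ^ 2 * (32 * ‖θ r - θstar‖ ^ 2) + 288 * ((H * η * L) ^ 4 * σ ^ 2) := by ring
      _ ≤ (H * η * L) ^ 2 * (32 * (2 * ‖θ t - θstar‖ ^ 2 + 2 * ‖θ t - θ r‖ ^ 2)) +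
            288 * ((H * η * L) ^ 4 * σ ^ 2) := by
          gcongr
          exact (pow_le_pow_left₀ (norm_nonneg _) h2 2).trans (hsq _ _)
      _ = _ := by ring
  have hsum : ‖∑ r ∈ Ico s t, e r‖ ^ 2 ≤ ((t - s : ℕ) : ℝ) * ∑ r ∈ Ico s t, ‖e r‖ ^ 2 := by
    refine (pow_le_pow_left₀ (norm_nonneg _) (norm_sum_le _ _) 2).trans ?_
    have := sq_sum_le_card_mul_sum_sq (s := Ico s t) (f := fun r => ‖e r‖)
    rwa [Nat.card_Ico] at this
  have hW : ‖(η / (M : ℝ)) • W‖ ^ 2 = (η / M) ^ 2 * ‖W‖ ^ 2 := by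
    rw [norm_smul, mul_pow, Real.norm_eq_abs, sq_abs]
  have htri : ‖θ t - θ s‖ ^ 2 ≤ 2 * ‖(η / (M : ℝ)) • W‖ ^ 2 + 2 * ‖∑ r ∈ Ico s t, e r‖ ^ 2 := by
    rw [hdecomp]
    have h1 := parallelogram_law_with_norm ℝ ((η / (M : ℝ)) • W) (∑ r ∈ Ico s t, e r)
    nlinarith [sq_nonneg ‖(η / (M : ℝ)) • W - ∑ r ∈ Ico s t, e r‖]
  rw [hW] at htri
  refine htri.trans ?_
  gcongr
  refine hsum.trans ?_
  gcongr with r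
  exact herr r

end Dynamics

lemma mul_pow_le_of_mixTime_le {M : ℕ} {c ρi : Fin M → ℝ} (hc : ∀ i, 1 ≤ c i)
    (hρi : ∀ i, ρi i ∈ Set.Ioo (0 : ℝ) 1) {ε : ℝ} (hε : 0 < ε) (i : Fin M) {m : ℕ}
    (hm : mixTime c ρi ε ≤ m) : c i * ρi i ^ m ≤ ε := by
  have hc0 : 0 < c i := zero_lt_one.trans_le (hc i)
  have hne : {t : ℕ | c i * ρi i ^ t ≤ ε}.Nonempty := by
    obtain ⟨n, hn⟩ := exists_pow_lt_of_lt_one (div_pos hε hc0) (hρi i).2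
    refine ⟨n, ?_⟩
    rw [lt_div_iff₀ hc0] at hn
    exact (mul_comm (c i) _).trans_le hn.le
  have hle : sInf {t : ℕ | c i * ρi i ^ t ≤ ε} ≤ m :=
    (Finset.le_sup (f := fun i => sInf {t : ℕ | c i * ρi i ^ t ≤ ε}) (Finset.mem_univ i)).trans hm
  refine le_trans ?_ (Nat.sInf_mem hne)
  exact mul_le_mul_of_nonneg_left (pow_le_pow_of_le_one (hρi i).1.le (hρi i).2.le hle) hc0.le

lemma Gbar_eq_sum {d : ℕ} {𝒳 : Type} [Fintype 𝒳] [MeasurableSpace 𝒳] [MeasurableSingletonClass 𝒳]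
    (G : EuclideanSpace ℝ (Fin d) → 𝒳 → EuclideanSpace ℝ (Fin d)) (μ : Measure 𝒳)
    [IsFiniteMeasure μ] (θ : EuclideanSpace ℝ (Fin d)) :
    Gbar G μ θ = ∑ x, (μ {x}).toReal • G θ x :=
  integral_fintype .of_finite

lemma norm_sum_smul_le_of_tv {𝒳 E : Type} [Fintype 𝒳] [NormedAddCommGroup E] [NormedSpace ℝ E]
    {p q : 𝒳 → ℝ} {δ B : ℝ} (hpq : 2⁻¹ * ∑ y, |p y - q y| ≤ δ) {X : 𝒳 → E}
    (hB0 : 0 ≤ B) (hB : ∀ y, ‖X y‖ ≤ B) (hq : ∑ y, q y • X y = 0) :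
    ‖∑ y, p y • X y‖ ≤ 2 * B * δ := by
  have h : ∑ y, p y • X y = ∑ y, (p y - q y) • X y := by
    simp only [sub_smul, Finset.sum_sub_distrib, hq, sub_zero]
  rw [h]
  calc _ ≤ ∑ y, |p y - q y| * B := by
        refine norm_sum_le_of_le _ fun y _ => ?_
        rw [norm_smul, Real.norm_eq_abs]
        exact mul_le_mul_of_nonneg_left (hB y) (abs_nonneg _)
    _ = 2 * B * (2⁻¹ * ∑ y, |p y - q y|) := by rw [← Finset.sum_mul]; ring
    _ ≤ 2 * B * δ := by gcongr

/-- A discrete backward Grönwall-type bound over a short window `[t - T, t]`. -/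
lemma backward_window_bound {D : ℕ → ℝ} {t T : ℕ} {V Δ x y : ℝ} (hD : ∀ s, 0 ≤ D s)
    (hΔ : 0 ≤ Δ) (hx : 0 ≤ x) (hy : 0 ≤ y) (hsmall : 256 * (T : ℝ) ^ 2 * x ≤ 1)
    (hrec : ∀ s, t - T ≤ s → s ≤ t → D s ≤ 2 * V +
      2 * (((t - s : ℕ) : ℝ) * ∑ r ∈ Ico s t, (64 * x * (Δ + D r) + 288 * y))) :
    D (t - T) ≤ 4 * V + 256 * (T : ℝ) ^ 2 * x * Δ + 1152 * ((T : ℝ) ^ 2 * y) := by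
  obtain ⟨s, hs, hmax⟩ := Finset.exists_max_image (Finset.Icc (t - T) t) D
    ⟨t, Finset.mem_Icc.2 ⟨Nat.sub_le _ _, le_rfl⟩⟩
  obtain ⟨hs1, hs2⟩ := Finset.mem_Icc.1 hs
  have hts : ((t - s : ℕ) : ℝ) ≤ T := by exact_mod_cast (by omega : t - s ≤ T)
  have hz : 0 ≤ 64 * x * (Δ + D s) + 288 * y := by have := hD s; positivity
  have hsum : ∑ r ∈ Ico s t, (64 * x * (Δ + D r) + 288 * y) ≤
      T * (64 * x * (Δ + D s) + 288 * y) := by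
    calc _ ≤ ∑ _r ∈ Ico s t, (64 * x * (Δ + D s) + 288 * y) := by
          refine Finset.sum_le_sum fun r hr => ?_
          have hr := Finset.mem_Ico.1 hr
          have := hmax r (Finset.mem_Icc.2 ⟨hs1.trans hr.1, hr.2.le⟩)
          gcongr
      _ ≤ _ := by
          rw [Finset.sum_const, Nat.card_Ico, nsmul_eq_mul]
          gcongr
  have h1 : D s ≤ 2 * V + 2 * ((T : ℝ) * (T * (64 * x * (Δ + D s) + 288 * y))) := by
    have := (mul_le_mul_of_nonneg_left hsum (Nat.cast_nonneg (t - s))).trans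
      (mul_le_mul_of_nonneg_right hts (mul_nonneg T.cast_nonneg hz))
    linarith [hrec s hs1 hs2]
  have h2 := hmax (t - T) (Finset.mem_Icc.2 ⟨le_rfl, Nat.sub_le _ _⟩)
  have h3 := mul_le_mul_of_nonneg_right hsmall (hD s)
  linarith


/-- Lemma 5: control of `E‖θ̄^{(t)} - θ̄^{(t-τ̄)}‖²` under Markovian sampling: with `α_g = 1`
and `η ≤ 1/(C̃ τ̄ H L²)`, for all `t ≥ 2τ̄`,
`E‖θ̄^{(t)} - θ̄^{(t-τ̄)}‖² ≤ C τ̄²L²α² E‖θ̄^{(t)} - θ*‖² + C(τ̄²L⁴α⁴σ² + τ̄²L²α²σ²/(MH(1-ρ)))`. -/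
theorem fedhsa_markov_iterate_difference_bound :
    ∃ Ctil : ℝ, 1 ≤ Ctil ∧ ∃ C : ℝ, ∀
    (d M H : ℕ) (hM : 0 < M) (hH : 0 < H)
    (𝒳 : Type) [Fintype 𝒳] [MeasurableSpace 𝒳] [MeasurableSingletonClass 𝒳] [DecidableEq 𝒳]
    (Ω : Type) [MeasurableSpace Ω] (P : Measure Ω) [IsProbabilityMeasure P]
    (o : Fin M → ℕ → Ω → 𝒳) (hmeas : ∀ i t, Measurable (o i t))
    (G : Fin M → EuclideanSpace ℝ (Fin d) → 𝒳 → EuclideanSpace ℝ (Fin d))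
    (μloc : Fin M → Measure 𝒳) (hμprob : ∀ i, IsProbabilityMeasure (μloc i))
    (θstar : EuclideanSpace ℝ (Fin d))
    (hroot : (M : ℝ)⁻¹ • ∑ i, Gbar (G i) (μloc i) θstar = 0)
    (L : ℝ) (hL : 1 ≤ L)
    (hLip : ∀ (i : Fin M) (x : 𝒳) (θ₁ θ₂ : EuclideanSpace ℝ (Fin d)),
      ‖G i θ₁ x - G i θ₂ x‖ ≤ L * ‖θ₁ - θ₂‖)
    (σa : Fin M → ℝ) (hσa : ∀ i, 1 ≤ σa i)
    (hGbnd : ∀ (i : Fin M) (θ : EuclideanSpace ℝ (Fin d)) (x : 𝒳),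
      ‖G i θ x‖ ≤ L * (‖θ‖ + σa i))
    (σ : ℝ) (hσ : σ = max (⨆ i, σa i) (max ‖θstar‖ 1))
    (μ0 : ℝ) (hμ0 : μ0 ∈ Set.Ioc (0 : ℝ) 1)
    (hmono : ∀ θ : EuclideanSpace ℝ (Fin d),
      ⟪θ - θstar, ((M : ℝ)⁻¹ • ∑ i, Gbar (G i) (μloc i) θ) -
        ((M : ℝ)⁻¹ • ∑ i, Gbar (G i) (μloc i) θstar)⟫ ≤ -μ0 * ‖θ - θstar‖ ^ 2)
    (K : Fin M → Matrix 𝒳 𝒳 ℝ)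
    (hK0 : ∀ i x y, 0 ≤ K i x y) (hK1 : ∀ i x, ∑ y, K i x y = 1)
    (hMarkov : ∀ (i : Fin M) (t : ℕ) (x : ℕ → 𝒳),
      P {ω | ∀ s ≤ t + 1, o i s ω = x s} =
        P {ω | ∀ s ≤ t, o i s ω = x s} * ENNReal.ofReal (K i (x t) (x (t + 1))))
    (hstat : ∀ (i : Fin M) (y : 𝒳), ∑ x, (μloc i {x}).toReal * K i x y = (μloc i {y}).toReal)
    (c ρi : Fin M → ℝ) (hc : ∀ i, 1 ≤ c i) (hρi : ∀ i, ρi i ∈ Set.Ioo (0 : ℝ) 1)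
    (hmix : ∀ (i : Fin M) (s : 𝒳) (t : ℕ), 0 < t →
      2⁻¹ * ∑ y, |(K i ^ t) s y - (μloc i {y}).toReal| ≤ c i * ρi i ^ t)
    (hindep : ∀ i j : Fin M, i ≠ j →
      IndepFun (fun ω (t : ℕ) => o i t ω) (fun ω (t : ℕ) => o j t ω) P)
    (η : ℝ) (hη : 0 < η) (θ0 : EuclideanSpace ℝ (Fin d))
    (hηs : η ≤ 1 / (Ctil * (mixTime c ρi (((H : ℝ) * η) ^ 2) : ℝ) * (H : ℝ) * L ^ 2)),
    ∀ t : ℕ, 2 * mixTime c ρi (((H : ℝ) * η) ^ 2) ≤ t →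
      ∫ ω, ‖hsaGlobal G o η 1 H θ0 (t) ω - hsaGlobal G o η 1 H θ0 (t - mixTime c ρi (((H : ℝ) * η) ^ 2)) ω‖ ^ 2 ∂P ≤
        C * (mixTime c ρi (((H : ℝ) * η) ^ 2) : ℝ) ^ 2 * L ^ 2 * ((H : ℝ) * η) ^ 2 * (∫ ω, ‖hsaGlobal G o η 1 H θ0 (t) ω - θstar‖ ^ 2 ∂P) +
        C * ((mixTime c ρi (((H : ℝ) * η) ^ 2) : ℝ) ^ 2 * L ^ 4 * ((H : ℝ) * η) ^ 4 * σ ^ 2 +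
          (mixTime c ρi (((H : ℝ) * η) ^ 2) : ℝ) ^ 2 * L ^ 2 * ((H : ℝ) * η) ^ 2 * σ ^ 2 / (((M : ℝ) * (H : ℝ)) * (1 - (⨆ i, ρi i)))) := by
  refine ⟨16, by norm_num, 1408, ?_⟩
  intro d M H hM hH 𝒳 _ _ _ _ Ω _ P _ o hmeas G μloc hμprob θstar hroot L hL hLip σa hσa hGbnd σ
    hσ μ0 hμ0 hmono K hK0 hK1 hMarkov hstat c ρi hc hρi hmix hindep η hη θ0 hηs t ht
  have hα0 : 0 < (H : ℝ) * η := by positivity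
  have hmixτ : ∀ i m, mixTime c ρi (((H : ℝ) * η) ^ 2) ≤ m →
      c i * ρi i ^ m ≤ ((H : ℝ) * η) ^ 2 :=
    fun i m hm => mul_pow_le_of_mixTime_le hc hρi (by positivity) i hm
  generalize mixTime c ρi (((H : ℝ) * η) ^ 2) = T at hηs ht hmixτ ⊢
  have hT : 0 < T := by
    refine Nat.pos_of_ne_zero fun h => ?_
    subst h
    simp only [Nat.cast_zero, mul_zero, zero_mul, div_zero] at hηs
    exact hη.not_ge hηs
  have hT1 : (1 : ℝ) ≤ T := by exact_mod_cast hT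
  have hL0 : 0 < L := zero_lt_one.trans_le hL
  have hstep : 16 * (T * (H * η) * L ^ 2) ≤ 1 := by
    rw [le_div_iff₀ (by positivity)] at hηs
    linarith
  have hTaL : 16 * (T * (H * η * L)) ≤ 1 := by
    have : T * (H * η * L) ≤ T * (H * η) * L ^ 2 := by
      calc T * (H * η * L) ≤ T * (H * η * L) * L := le_mul_of_one_le_right (by positivity) hL
        _ = _ := by ring
    linarith
  have haL : 16 * (H * η * L) ≤ 1 := by
    have : H * η * L ≤ T * (H * η * L) := le_mul_of_one_le_left (by positivity) hT1
    linarith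
  have hα1 : H * η ≤ 1 := by
    have : H * η ≤ H * η * L := le_mul_of_one_le_right hα0.le hL
    linarith
  have hσa_le : ∀ i, σa i ≤ σ := fun i =>
    hσ ▸ (le_ciSup (Set.finite_range σa).bddAbove i).trans (le_max_left _ _)
  have hθσ : ‖θstar‖ ≤ σ := hσ ▸ (le_max_left _ _).trans (le_max_right _ _)
  have hσ0 : 0 ≤ σ := (norm_nonneg _).trans hθσ
  have hG : ∀ (i : Fin M) (θ : EuclideanSpace ℝ (Fin d)) (x : 𝒳), ‖G i θ x‖ ≤ L * (‖θ‖ + σ) :=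
    fun i θ x => (hGbnd i θ x).trans (by gcongr; exact hσa_le i)
  set A : Fin M → EuclideanSpace ℝ (Fin d) := fun i => Gbar (G i) (μloc i) θstar
  have hA : ∑ i, A i = 0 := by
    rcases smul_eq_zero.1 hroot with h | h
    · exact absurd h (by positivity)
    · exact h
  have hGs : ∀ i x, ‖G i θstar x‖ ≤ 2 * L * σ := fun i x =>
    (hG i θstar x).trans (by nlinarith)
  have hμ1 : ∀ i, ∑ x, (μloc i {x}).toReal = 1 := by
    intro i
    have := hμprob i
    have h := sum_measureReal_preimage_eq_one (P := μloc i) (measurable_id (α := 𝒳))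
    simpa [measureReal_def] using h
  have hAsum : ∀ i, A i = ∑ x, (μloc i {x}).toReal • G i θstar x := fun i =>
    have := hμprob i
    Gbar_eq_sum _ _ _
  have hAn : ∀ i, ‖A i‖ ≤ 2 * L * σ := by
    intro i
    rw [hAsum]
    calc _ ≤ ∑ x, (μloc i {x}).toReal * (2 * L * σ) := by
          refine norm_sum_le_of_le _ fun x _ => ?_
          rw [norm_smul, Real.norm_of_nonneg ENNReal.toReal_nonneg]
          exact mul_le_mul_of_nonneg_left (hGs i x) ENNReal.toReal_nonneg
      _ = _ := by rw [← Finset.sum_mul, hμ1, one_mul]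
  have hB0 : 0 ≤ 4 * L * σ := by positivity
  have hB : ∀ i x, ‖G i θstar x - A i‖ ≤ 4 * L * σ := fun i x =>
    (norm_sub_le _ _).trans (by linarith [hGs i x, hAn i])
  have hX : ∀ i x m, T ≤ m → ‖∑ y, (K i ^ m) x y • (G i θstar y - A i)‖ ≤
      2 * (4 * L * σ) * ((H : ℝ) * η) ^ 2 := by
    intro i x m hm
    refine norm_sum_smul_le_of_tv ((hmix i x m (by omega)).trans (hmixτ i m hm)) hB0 (hB i) ?_
    simp only [smul_sub, Finset.sum_sub_distrib, ← Finset.sum_smul, hμ1, one_smul, ← hAsum,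
      sub_self]
  have hInt : ∀ N (f : Ω → ℝ), (∀ ω ω', (∀ i, ∀ k < N, o i k ω = o i k ω') → f ω = f ω') →
      Integrable f P := by
    intro N f hf
    refine integrable_of_factorsThrough
      (Z := fun ω (i : Fin M) (k : Fin N) => o i k ω)
      (measurable_pi_lambda _ fun i => measurable_pi_lambda _ fun k => hmeas i k) ?_
    exact fun ω ω' h => hf ω ω' fun i k hk => congrFun (congrFun h i) ⟨k, hk⟩
  have hcongr : ∀ r ≤ t, ∀ ω ω', (∀ i, ∀ k < t * H, o i k ω = o i k ω') →
      hsaGlobal G o η 1 H θ0 r ω = hsaGlobal G o η 1 H θ0 r ω' := fun r hr ω ω' h =>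
    hsaGlobal_congr (Nat.mul_le_mul_right H hr) h 1 θ0
  have hintΔ : Integrable (fun ω => ‖hsaGlobal G o η 1 H θ0 t ω - θstar‖ ^ 2) P :=
    hInt (t * H) _ fun ω ω' h => by rw [hcongr t le_rfl ω ω' h]
  have hintD : ∀ r ≤ t, Integrable
      (fun ω => ‖hsaGlobal G o η 1 H θ0 t ω - hsaGlobal G o η 1 H θ0 r ω‖ ^ 2) P :=
    fun r hr => hInt (t * H) _ fun ω ω' h => by
      rw [hcongr t le_rfl ω ω' h, hcongr r hr ω ω' h]
  have hintW : ∀ s, Integrable (fun ω =>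
      ‖∑ i, ∑ k ∈ Ico (s * H) (t * H), (G i θstar (o i k ω) - A i)‖ ^ 2) P :=
    fun s => hInt (t * H) _ fun ω ω' h => by
      rw [Finset.sum_congr rfl fun i _ => Finset.sum_congr rfl fun k hk => by
        rw [h i k (Finset.mem_Ico.1 hk).2]]
  set Δ := ∫ ω, ‖hsaGlobal G o η 1 H θ0 t ω - θstar‖ ^ 2 ∂P
  set D : ℕ → ℝ := fun s =>
    ∫ ω, ‖hsaGlobal G o η 1 H θ0 t ω - hsaGlobal G o η 1 H θ0 s ω‖ ^ 2 ∂P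
  have hV : ∀ s, t - T ≤ s → s ≤ t → (η / M) ^ 2 *
      ∫ ω, ‖∑ i, ∑ k ∈ Ico (s * H) (t * H), (G i θstar (o i k ω) - A i)‖ ^ 2 ∂P ≤
        32 * ((T : ℝ) ^ 2 * L ^ 2 * (H * η) ^ 2 * σ ^ 2 / (M * H)) +
          64 * ((T : ℝ) ^ 2 * L ^ 2 * (H * η) ^ 4 * σ ^ 2) := by
    intro s hs1 hs2
    have hs : T ≤ s * H := (by omega : T ≤ s).trans (Nat.le_mul_of_pos_right s hH)
    have h1 := integral_norm_sq_noise_le (X := fun i x => G i θstar x - A i) (b := t * H) hmeas hK0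
      hMarkov hindep hB0 hB (by positivity) (pow_le_one₀ hα0.le hα1) hX hs
    have hn : ((t * H - s * H : ℕ) : ℝ) ≤ T * H := by
      rw [← Nat.sub_mul]
      exact_mod_cast Nat.mul_le_mul_right H (by omega : t - s ≤ T)
    calc _ ≤ (η / M) ^ 2 * (M * (T * H) * (2 * T) * (4 * L * σ) ^ 2 +
          (M * (T * H)) ^ 2 * (4 * (4 * L * σ) ^ 2 * ((H : ℝ) * η) ^ 2)) := by
          refine mul_le_mul_of_nonneg_left (h1.trans ?_) (sq_nonneg _)
          gcongr
      _ = _ := by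
          field_simp
          ring
  set V := 32 * ((T : ℝ) ^ 2 * L ^ 2 * (H * η) ^ 2 * σ ^ 2 / (M * H)) +
    64 * ((T : ℝ) ^ 2 * L ^ 2 * (H * η) ^ 4 * σ ^ 2) with hVdef
  have hrec : ∀ s, t - T ≤ s → s ≤ t → D s ≤ 2 * V + 2 * (((t - s : ℕ) : ℝ) *
      ∑ r ∈ Ico s t, (64 * (H * η * L) ^ 2 * (Δ + D r) + 288 * ((H * η * L) ^ 4 * σ ^ 2))) := by
    intro s hs1 hs2
    have hterm : ∀ r ∈ Ico s t, Integrable (fun ω =>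
        64 * (H * η * L) ^ 2 * (‖hsaGlobal G o η 1 H θ0 t ω - θstar‖ ^ 2 +
            ‖hsaGlobal G o η 1 H θ0 t ω - hsaGlobal G o η 1 H θ0 r ω‖ ^ 2) +
          288 * ((H * η * L) ^ 4 * σ ^ 2)) P := fun r hr =>
      ((hintΔ.add (hintD r (Finset.mem_Ico.1 hr).2.le)).const_mul _).add (integrable_const _)
    have hmono' := integral_mono (hintD s hs2)
      ((((hintW s).const_mul ((η / M) ^ 2)).const_mul 2).add
        (((integrable_finsetSum _ hterm).const_mul ((t - s : ℕ) : ℝ)).const_mul 2))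
      fun ω => norm_sq_hsaGlobal_sub_le hM hη.le hL0.le (by linarith) hLip hG hθσ hA θ0 hs2 ω
    refine hmono'.trans ?_
    have hsum : ∫ ω, ∑ r ∈ Ico s t,
        (64 * (H * η * L) ^ 2 * (‖hsaGlobal G o η 1 H θ0 t ω - θstar‖ ^ 2 +
            ‖hsaGlobal G o η 1 H θ0 t ω - hsaGlobal G o η 1 H θ0 r ω‖ ^ 2) +
          288 * ((H * η * L) ^ 4 * σ ^ 2)) ∂P =
        ∑ r ∈ Ico s t, (64 * (H * η * L) ^ 2 * (Δ + D r) + 288 * ((H * η * L) ^ 4 * σ ^ 2)) := by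
      rw [integral_finsetSum _ hterm]
      refine Finset.sum_congr rfl fun r hr => ?_
      have hr := hintD r (Finset.mem_Ico.1 hr).2.le
      have hadd : Integrable (fun ω => ‖hsaGlobal G o η 1 H θ0 t ω - θstar‖ ^ 2 +
          ‖hsaGlobal G o η 1 H θ0 t ω - hsaGlobal G o η 1 H θ0 r ω‖ ^ 2) P := hintΔ.add hr
      rw [integral_add (hadd.const_mul _) (integrable_const _), integral_const_mul,
        integral_add hintΔ hr, integral_const, probReal_univ, one_smul]
    simp only [Pi.add_apply]
    rw [integral_add (((hintW s).const_mul ((η / M) ^ 2)).const_mul 2)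
      (((integrable_finsetSum _ hterm).const_mul ((t - s : ℕ) : ℝ)).const_mul 2),
      integral_const_mul, integral_const_mul, integral_const_mul, integral_const_mul, hsum]
    linarith [hV s hs1 hs2]
  have hΔ0 : 0 ≤ Δ := integral_nonneg fun ω => sq_nonneg _
  have hfin := backward_window_bound (fun s => integral_nonneg fun ω => sq_nonneg _) hΔ0
    (sq_nonneg _) (by positivity) (by nlinarith [show 0 ≤ T * (H * η * L) by positivity]) hrec
  have : Nonempty (Fin M) := ⟨⟨0, hM⟩⟩
  have hρ1 : 0 < 1 - ⨆ i, ρi i := by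
    obtain ⟨i, hi⟩ := exists_eq_ciSup_of_finite (f := ρi)
    rw [← hi]
    linarith [(hρi i).2]
  have hρ0 : 1 - ⨆ i, ρi i ≤ 1 := by
    have := Real.iSup_nonneg fun i => (hρi i).1.le
    linarith
  have hvar : (T : ℝ) ^ 2 * L ^ 2 * (H * η) ^ 2 * σ ^ 2 / (M * H) ≤
      (T : ℝ) ^ 2 * L ^ 2 * (H * η) ^ 2 * σ ^ 2 / (M * H * (1 - ⨆ i, ρi i)) :=
    div_le_div_of_nonneg_left (by positivity) (by positivity)
      (mul_le_of_le_one_right (by positivity) hρ0)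
  have hvar0 : 0 ≤ (T : ℝ) ^ 2 * L ^ 2 * (H * η) ^ 2 * σ ^ 2 / (M * H) := by positivity
  have hL4 : (T : ℝ) ^ 2 * L ^ 2 * (H * η) ^ 4 * σ ^ 2 ≤
      (T : ℝ) ^ 2 * L ^ 4 * (H * η) ^ 4 * σ ^ 2 := by
    gcongr
    norm_num
  have hΔc : 0 ≤ (T : ℝ) ^ 2 * L ^ 2 * (H * η) ^ 2 * Δ := by positivity
  refine hfin.trans ?_
  rw [hVdef]
  have e1 : 256 * (T : ℝ) ^ 2 * (H * η * L) ^ 2 * Δ =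
      256 * ((T : ℝ) ^ 2 * L ^ 2 * (H * η) ^ 2 * Δ) := by ring
  have e2 : 1152 * ((T : ℝ) ^ 2 * ((H * η * L) ^ 4 * σ ^ 2)) =
      1152 * ((T : ℝ) ^ 2 * L ^ 4 * (H * η) ^ 4 * σ ^ 2) := by ring
  rw [e1, e2]
  linarith
end
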